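/- Strong converse exponent bound: let N, M : A → B be quantum channels, n ∈ ℕ, and r > 0. For any n-round adaptive channel discrimination protocol whose type II error probability satisfies β_n ≤ 2^{−rn}, the type I error probability satisfies −(1/n) log₂(1 − α_n) ≥ sup_{α>1} ((α−1)/α) · (r − D̃_α^A(N‖M)) ≥ r − D_max(N‖M), where D̃_α^A is the amortized sandwiched Rényi channel divergence and D_max(N‖M) is the max-relative entropy channel divergence. -/

import Mathlib

open scoped BigOperators ComplexOrder

noncomputable section

attribute [local instance] Classical.propDecidable

/-- A density matrix (quantum state): positive semidefinite with unit trace. -/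
def IsDensity {ι : Type} [Fintype ι] (ρ : Matrix ι ι ℂ) : Prop :=
  ρ.PosSemidef ∧ ρ.trace = 1

/-- The map `id_R ⊗ Φ` (for linear `Φ`), defined blockwise. -/
def idTensor {R ι κ : Type} (Φ : Matrix ι ι ℂ → Matrix κ κ ℂ)
    (X : Matrix (R × ι) (R × ι) ℂ) : Matrix (R × κ) (R × κ) ℂ :=
  fun p q => Φ (fun a b => X (p.1, a) (q.1, b)) p.2 q.2

/-- The map `Φ ⊗ id_E` (for linear `Φ`), defined blockwise. -/
def tensorId {ι κ E : Type} (Φ : Matrix ι ι ℂ → Matrix κ κ ℂ)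
    (X : Matrix (ι × E) (ι × E) ℂ) : Matrix (κ × E) (κ × E) ℂ :=
  fun p q => Φ (fun a b => X (a, p.2) (b, q.2)) p.1 q.1

/-- A quantum channel: linear, trace preserving, and completely positive. -/
structure IsChannel {ι κ : Type} [Fintype ι] [Fintype κ]
    (Φ : Matrix ι ι ℂ → Matrix κ κ ℂ) : Prop where
  linear : IsLinearMap ℂ Φ
  tracePres : ∀ X, (Φ X).trace = X.trace
  compPos : ∀ (k : ℕ) (X : Matrix (Fin k × ι) (Fin k × ι) ℂ),
      X.PosSemidef → (idTensor Φ X).PosSemidef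

/-- A family of divergences, one for every finite dimension. -/
abbrev DivFam : Type 1 :=
  ∀ (ι : Type) [Fintype ι] [DecidableEq ι], Matrix ι ι ℂ → Matrix ι ι ℂ → EReal

/-- Data processing: a generalized divergence does not increase under channels. -/
def DivDataProcessing (D : DivFam) : Prop :=
  ∀ (ι κ : Type) [Fintype ι] [DecidableEq ι] [Fintype κ] [DecidableEq κ]
    (Φ : Matrix ι ι ℂ → Matrix κ κ ℂ), IsChannel Φ →
    ∀ ρ σ : Matrix ι ι ℂ, IsDensity ρ → IsDensity σ →
      D κ (Φ ρ) (Φ σ) ≤ D ι ρ σ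

/-- Faithfulness: `D(ρ‖ρ) ≤ 0` for every state `ρ`. -/
def DivFaithful (D : DivFam) : Prop :=
  ∀ (ι : Type) [Fintype ι] [DecidableEq ι] (ρ : Matrix ι ι ℂ),
    IsDensity ρ → D ι ρ ρ ≤ 0

/-- Strong faithfulness: `D(ρ‖σ) = 0` iff `ρ = σ`. -/
def DivStronglyFaithful (D : DivFam) : Prop :=
  ∀ (ι : Type) [Fintype ι] [DecidableEq ι] (ρ σ : Matrix ι ι ℂ),
    IsDensity ρ → IsDensity σ → (D ι ρ σ = 0 ↔ ρ = σ)

/-- The generalized channel divergence `D(N‖M)`. -/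
def channelDiv (D : DivFam) {ι κ : Type} [Fintype ι] [DecidableEq ι] [Fintype κ] [DecidableEq κ]
    (N M : Matrix ι ι ℂ → Matrix κ κ ℂ) : EReal :=
  ⨆ (R : ℕ) (ρ : Matrix (Fin R × ι) (Fin R × ι) ℂ) (_ : IsDensity ρ),
    D (Fin R × κ) (idTensor N ρ) (idTensor M ρ)

/-- The amortized channel divergence `D^𝒜(N‖M)`. -/
def amortizedDiv (D : DivFam) {ι κ : Type} [Fintype ι] [DecidableEq ι] [Fintype κ] [DecidableEq κ]
    (N M : Matrix ι ι ℂ → Matrix κ κ ℂ) : EReal :=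
  ⨆ (R : ℕ) (ρ : Matrix (Fin R × ι) (Fin R × ι) ℂ) (σ : Matrix (Fin R × ι) (Fin R × ι) ℂ)
    (_ : IsDensity ρ) (_ : IsDensity σ),
      D (Fin R × κ) (idTensor N ρ) (idTensor M σ) - D (Fin R × ι) ρ σ

/-- Apply a real function to a Hermitian matrix via the spectral decomposition. -/
def hermFun {ι : Type} [Fintype ι] [DecidableEq ι] (f : ℝ → ℝ) (A : Matrix ι ι ℂ) :
    Matrix ι ι ℂ :=
  if hA : A.IsHermitian then
    (hA.eigenvectorUnitary : Matrix ι ι ℂ) *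
      Matrix.diagonal (fun i => (f (hA.eigenvalues i) : ℂ)) *
      star (hA.eigenvectorUnitary : Matrix ι ι ℂ)
  else 0

/-- Real matrix power via spectral calculus, with the generalized-inverse convention `0 ↦ 0`. -/
def matPow {ι : Type} [Fintype ι] [DecidableEq ι] (A : Matrix ι ι ℂ) (r : ℝ) : Matrix ι ι ℂ :=
  hermFun (fun x => if x = 0 then 0 else Real.rpow x r) A

/-- Matrix base-2 logarithm via spectral calculus, taken on the support. -/
def matLog2 {ι : Type} [Fintype ι] [DecidableEq ι] (A : Matrix ι ι ℂ) : Matrix ι ι ℂ :=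
  hermFun (fun x => if x = 0 then 0 else Real.logb 2 x) A

/-- The projection onto the support of a Hermitian matrix. -/
def suppProj {ι : Type} [Fintype ι] [DecidableEq ι] (A : Matrix ι ι ℂ) : Matrix ι ι ℂ :=
  hermFun (fun x => if x = 0 then 0 else 1) A

/-- `supp ρ ⊆ supp σ`, expressed (for Hermitian matrices) as kernel containment
`ker σ ⊆ ker ρ`. -/
def suppLE {ι : Type} [Fintype ι] (ρ σ : Matrix ι ι ℂ) : Prop :=
  ∀ v : ι → ℂ, σ.mulVec v = 0 → ρ.mulVec v = 0

/-- The quantum relative entropy `D(ρ‖σ) = Tr[ρ(log₂ρ − log₂σ)]`,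
`+∞` if the support condition fails. -/
def relEnt {ι : Type} [Fintype ι] [DecidableEq ι] (ρ σ : Matrix ι ι ℂ) : EReal :=
  if suppLE ρ σ then (((ρ * (matLog2 ρ - matLog2 σ)).trace).re : EReal) else ⊤

/-- `−log₂ x` as an extended real, with `−log₂ 0 = +∞`. -/
def negLog2 (x : ℝ) : EReal :=
  if x ≤ 0 then ⊤ else ((-Real.logb 2 x : ℝ) : EReal)

/-- The max-relative entropy `D_max(ρ‖σ) = inf{λ : ρ ≤ 2^λ σ}` (Loewner order). -/
def Dmax {ι : Type} [Fintype ι] (ρ σ : Matrix ι ι ℂ) : EReal :=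
  ⨅ (l : ℝ) (_ : (((2 : ℝ) ^ l) • σ - ρ).PosSemidef), (l : EReal)

/-- The sandwiched Rényi divergence `D̃_α`. -/
def sandRenyi {ι : Type} [Fintype ι] [DecidableEq ι] (α : ℝ) (ρ σ : Matrix ι ι ℂ) : EReal :=
  if α = 1 then relEnt ρ σ
  else if 1 < α ∧ ¬ suppLE ρ σ then ⊤
  else if α < 1 ∧ (ρ * σ).trace = 0 then ⊤
  else ((((α - 1)⁻¹ *
      Real.logb 2
        (((matPow (matPow σ ((1 - α) / (2 * α)) * ρ * matPow σ ((1 - α) / (2 * α))) α).trace).re)) :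
        ℝ) : EReal)

/-- The Petz–Rényi divergence `D_α`. -/
def petzRenyi {ι : Type} [Fintype ι] [DecidableEq ι] (α : ℝ) (ρ σ : Matrix ι ι ℂ) : EReal :=
  if α = 0 then negLog2 (((suppProj ρ * σ).trace).re)
  else if α = 1 then relEnt ρ σ
  else if 1 < α ∧ ¬ suppLE ρ σ then ⊤
  else if α < 1 ∧ (ρ * σ).trace = 0 then ⊤
  else ((((α - 1)⁻¹ * Real.logb 2 (((matPow ρ α * matPow σ (1 - α)).trace).re)) : ℝ) : EReal)

/-- The trace norm `‖X‖₁ = Tr √(XᴴX)`. -/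
def traceNorm {ι : Type} [Fintype ι] [DecidableEq ι] (X : Matrix ι ι ℂ) : ℝ :=
  ((matPow (X.conjTranspose * X) (1/2 : ℝ)).trace).re

/-- The fidelity `F(ρ,σ) = ‖√ρ√σ‖₁²`. -/
def matFidelity {ι : Type} [Fintype ι] [DecidableEq ι] (ρ σ : Matrix ι ι ℂ) : ℝ :=
  (traceNorm (matPow ρ (1/2 : ℝ) * matPow σ (1/2 : ℝ))) ^ 2

def relEntFam : DivFam := fun _ _ _ ρ σ => relEnt ρ σ
def DmaxFam : DivFam := fun _ _ _ ρ σ => Dmax ρ σ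
def sandFam (α : ℝ) : DivFam := fun _ _ _ ρ σ => sandRenyi α ρ σ
def petzFam (α : ℝ) : DivFam := fun _ _ _ ρ σ => petzRenyi α ρ σ
/-- `D̃_{1/2}(ρ‖σ) = −log₂ F(ρ,σ)` as a divergence family. -/
def fidDivFam : DivFam := fun _ _ _ ρ σ => negLog2 (matFidelity ρ σ)

/-- The classical-quantum state `Σ_x p(x) |x⟩⟨x| ⊗ ρ^x`. -/
def cqState {X ι : Type} [DecidableEq X] (p : X → ℝ) (ρ : X → Matrix ι ι ℂ) :
    Matrix (X × ι) (X × ι) ℂ :=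
  fun a b => if a.1 = b.1 then (p a.1 : ℂ) * ρ a.1 a.2 b.2 else 0

/-- The direct-sum property of a generalized divergence on classical-quantum states. -/
def DivDirectSum (D : DivFam) : Prop :=
  ∀ (X ι : Type) [Fintype X] [DecidableEq X] [Fintype ι] [DecidableEq ι]
    (p : X → ℝ), (∀ x, 0 ≤ p x) → (∑ x, p x = 1) →
    ∀ (ρ σ : X → Matrix ι ι ℂ), (∀ x, IsDensity (ρ x)) → (∀ x, IsDensity (σ x)) →
      D (X × ι) (cqState p ρ) (cqState p σ) = ∑ x, (p x : EReal) * D ι (ρ x) (σ x)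

/-- The Kronecker (tensor) product of square matrices. -/
def mkron {ι E : Type} (A : Matrix ι ι ℂ) (B : Matrix E E ℂ) : Matrix (ι × E) (ι × E) ℂ :=
  fun p q => A p.1 q.1 * B p.2 q.2

/-- Sub-additivity of a divergence with respect to tensor-product states. -/
def DivSubAdditive (D : DivFam) : Prop :=
  ∀ (ι E : Type) [Fintype ι] [DecidableEq ι] [Fintype E] [DecidableEq E]
    (ρ σ : Matrix ι ι ℂ) (ω τ : Matrix E E ℂ),
    IsDensity ρ → IsDensity σ → IsDensity ω → IsDensity τ →
      D (ι × E) (mkron ρ ω) (mkron σ τ) ≤ D ι ρ σ + D E ω τ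

/-- The classical-quantum channel `ρ ↦ Σ_x ⟨x|ρ|x⟩ ν^x`. -/
def cqChannel {X κ : Type} [Fintype X] [Fintype κ] (ν : X → Matrix κ κ ℂ) :
    Matrix X X ℂ → Matrix κ κ ℂ :=
  fun ρ => ∑ x, ρ x x • ν x

/-- The maximally entangled state of Schmidt rank `|ι|` on `ι × ι`. -/
def maxEnt (ι : Type) [Fintype ι] [DecidableEq ι] : Matrix (ι × ι) (ι × ι) ℂ :=
  fun p q => if p.1 = p.2 ∧ q.1 = q.2 then ((Fintype.card ι : ℂ))⁻¹ else 0

/-- An `(m+1)`-round adaptive channel discrimination protocol: registers `R_0, …, R_m`,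
a shared initial state, adaptive channels between channel uses, and a final measurement. -/
structure Protocol (ι κ : Type) [Fintype ι] [DecidableEq ι] [Fintype κ] [DecidableEq κ]
    (m : ℕ) where
  r : ℕ → ℕ
  init : Matrix (Fin (r 0) × ι) (Fin (r 0) × ι) ℂ
  init_density : IsDensity init
  adapt : ∀ i : ℕ, Matrix (Fin (r i) × κ) (Fin (r i) × κ) ℂ →
      Matrix (Fin (r (i + 1)) × ι) (Fin (r (i + 1)) × ι) ℂ
  adapt_channel : ∀ i, i < m → IsChannel (adapt i)
  meas : Matrix (Fin (r m) × κ) (Fin (r m) × κ) ℂ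
  meas_psd : meas.PosSemidef
  meas_le_one : ((1 : Matrix (Fin (r m) × κ) (Fin (r m) × κ) ℂ) - meas).PosSemidef

namespace Protocol

variable {ι κ : Type} [Fintype ι] [DecidableEq ι] [Fintype κ] [DecidableEq κ] {m : ℕ}

/-- The state on `R_i ⊗ A` just before the `(i+1)`-st channel use, when the channel is `Ch`. -/
def evolve (P : Protocol ι κ m) (Ch : Matrix ι ι ℂ → Matrix κ κ ℂ) :
    (i : ℕ) → Matrix (Fin (P.r i) × ι) (Fin (P.r i) × ι) ℂ
  | 0 => P.init
  | (i + 1) => P.adapt i (idTensor Ch (P.evolve Ch i))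

/-- The final state on `R_m ⊗ B` after all `m + 1` channel uses. -/
def final (P : Protocol ι κ m) (Ch : Matrix ι ι ℂ → Matrix κ κ ℂ) :
    Matrix (Fin (P.r m) × κ) (Fin (P.r m) × κ) ℂ :=
  idTensor Ch (P.evolve Ch m)

/-- The probability of accepting (deciding for the null hypothesis). -/
def acceptProb (P : Protocol ι κ m) (Ch : Matrix ι ι ℂ → Matrix κ κ ℂ) : ℝ :=
  ((P.meas * P.final Ch).trace).re

/-- The type I error probability `Tr[(I − Q) ρ'⁽ⁿ⁾]`. -/
def typeI (P : Protocol ι κ m) (N : Matrix ι ι ℂ → Matrix κ κ ℂ) : ℝ :=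
  ((((1 : Matrix (Fin (P.r m) × κ) (Fin (P.r m) × κ) ℂ) - P.meas) * P.final N).trace).re

/-- The type II error probability `Tr[Q τ'⁽ⁿ⁾]`. -/
def typeII (P : Protocol ι κ m) (M : Matrix ι ι ℂ → Matrix κ κ ℂ) : ℝ :=
  ((P.meas * P.final M).trace).re

end Protocol

/-- The binary (classical) state `diag(p, 1−p)`. -/
def binState (p : ℝ) : Matrix (Fin 2) (Fin 2) ℂ :=
  Matrix.diagonal (fun i => if i = 0 then (p : ℂ) else ((1 - p : ℝ) : ℂ))

/-- The binary entropy `h₂(ε)`. -/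
def h2 (ε : ℝ) : ℝ := -(ε * Real.logb 2 ε) - (1 - ε) * Real.logb 2 (1 - ε)

/-- `ζ_n(ε, N, M)` with `n = m + 1`: the optimal type II error exponent among all
`(m+1)`-round adaptive protocols with type I error at most `ε`. -/
def steinExp {ι κ : Type} [Fintype ι] [DecidableEq ι] [Fintype κ] [DecidableEq κ]
    (N M : Matrix ι ι ℂ → Matrix κ κ ℂ) (m : ℕ) (ε : ℝ) : EReal :=
  ⨆ (P : Protocol ι κ m) (_ : P.typeI N ≤ ε),
    (((m + 1 : ℝ))⁻¹ : EReal) * negLog2 (P.typeII M)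

/-- Partial trace over the (left) reference system. -/
def ptraceLeft {R ι : Type} [Fintype R] (ψ : Matrix (R × ι) (R × ι) ℂ) : Matrix ι ι ℂ :=
  fun a b => ∑ r, ψ (r, a) (r, b)

/-- The energy-constrained generalized channel divergence. -/
def eChannelDiv (D : DivFam) {ι κ : Type} [Fintype ι] [DecidableEq ι] [Fintype κ] [DecidableEq κ]
    (H : Matrix ι ι ℂ) (E : ℝ) (N M : Matrix ι ι ℂ → Matrix κ κ ℂ) : EReal :=
  ⨆ (R : ℕ) (ψ : Matrix (Fin R × ι) (Fin R × ι) ℂ) (_ : IsDensity ψ)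
    (_ : ((H * ptraceLeft ψ).trace).re ≤ E),
      D (Fin R × κ) (idTensor N ψ) (idTensor M ψ)

/-- The energy-constrained amortized channel divergence. -/
def eAmortizedDiv (D : DivFam) {ι κ : Type} [Fintype ι] [DecidableEq ι] [Fintype κ] [DecidableEq κ]
    (H : Matrix ι ι ℂ) (E : ℝ) (N M : Matrix ι ι ℂ → Matrix κ κ ℂ) : EReal :=
  ⨆ (R : ℕ) (ρ : Matrix (Fin R × ι) (Fin R × ι) ℂ) (σ : Matrix (Fin R × ι) (Fin R × ι) ℂ)
    (_ : IsDensity ρ) (_ : IsDensity σ)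
    (_ : ((H * ptraceLeft ρ).trace).re ≤ E) (_ : ((H * ptraceLeft σ).trace).re ≤ E),
      D (Fin R × κ) (idTensor N ρ) (idTensor M σ) - D (Fin R × ι) ρ σ

/-- `sup_α(ρ/σ)`: supremum of `Tr[Λρ]/Tr[Λσ]` over Hermitian `Λ` with `α⁻¹ I ≤ Λ ≤ I`. -/
def hilbertSup {ι : Type} [Fintype ι] [DecidableEq ι] (α : ℝ) (ρ σ : Matrix ι ι ℂ) : ℝ :=
  sSup { t : ℝ | ∃ Λ : Matrix ι ι ℂ, Λ.IsHermitian ∧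
    (Λ - (α⁻¹ : ℝ) • (1 : Matrix ι ι ℂ)).PosSemidef ∧
    ((1 : Matrix ι ι ℂ) - Λ).PosSemidef ∧
    t = ((Λ * ρ).trace).re / ((Λ * σ).trace).re }

/-- The Hilbert `α`-divergence `H_α(ρ‖σ)`, with `H₁(ρ‖σ) = ‖ρ−σ‖₁ / (2 ln 2)`. -/
def hilbertDiv {ι : Type} [Fintype ι] [DecidableEq ι] (α : ℝ) (ρ σ : Matrix ι ι ℂ) : ℝ :=
  if α = 1 then (2 * Real.log 2)⁻¹ * traceNorm (ρ - σ)
  else (α / (α - 1)) * Real.logb 2 (hilbertSup α ρ σ)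

open Matrix

section SpectralCalculus

variable {n m : Type} [Fintype n] [DecidableEq n] [Fintype m] [DecidableEq m]

lemma hermFun_eq (f : ℝ → ℝ) {A : Matrix n n ℂ} (hA : A.IsHermitian) :
    hermFun f A = (hA.eigenvectorUnitary : Matrix n n ℂ) *
      Matrix.diagonal (fun i => (f (hA.eigenvalues i) : ℂ)) *
      star (hA.eigenvectorUnitary : Matrix n n ℂ) := by
  rw [hermFun, dif_pos hA]

lemma hermFun_eq_cfc (f : ℝ → ℝ) {A : Matrix n n ℂ} (hA : A.IsHermitian) :
    hermFun f A = cfc f A := by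
  rw [hA.cfc_eq, hermFun_eq f hA]
  rfl

lemma continuousOn_spectrum_matrix (f : ℝ → ℝ) (A : Matrix n n ℂ) :
    ContinuousOn f (spectrum ℝ A) :=
  (Matrix.finite_real_spectrum).continuousOn f

lemma isHermitian_hermFun (f : ℝ → ℝ) (A : Matrix n n ℂ) : (hermFun f A).IsHermitian := by
  by_cases hA : A.IsHermitian
  · rw [hermFun_eq_cfc f hA]
    exact cfc_predicate f A
  · rw [hermFun, dif_neg hA]
    exact Matrix.isHermitian_zero

lemma hermFun_id {A : Matrix n n ℂ} (hA : A.IsHermitian) : hermFun (fun x => x) A = A := by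
  rw [hermFun_eq_cfc _ hA]
  exact cfc_id' ℝ A hA

lemma hermFun_one {A : Matrix n n ℂ} (hA : A.IsHermitian) : hermFun (fun _ => 1) A = 1 := by
  rw [hermFun_eq_cfc _ hA]
  exact cfc_const_one ℝ A hA

lemma hermFun_mul (f g : ℝ → ℝ) {A : Matrix n n ℂ} (hA : A.IsHermitian) :
    hermFun f A * hermFun g A = hermFun (fun x => f x * g x) A := by
  simp only [hermFun_eq_cfc _ hA]
  exact (cfc_mul f g A (continuousOn_spectrum_matrix _ _) (continuousOn_spectrum_matrix _ _)).symm

lemma hermFun_hermFun (f g : ℝ → ℝ) {A : Matrix n n ℂ} (hA : A.IsHermitian) :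
    hermFun f (hermFun g A) = hermFun (fun x => f (g x)) A := by
  rw [hermFun_eq_cfc f (isHermitian_hermFun g A), hermFun_eq_cfc g hA, hermFun_eq_cfc _ hA]
  exact (cfc_comp f g A hA ((Matrix.finite_real_spectrum.image g).continuousOn f)
    (continuousOn_spectrum_matrix _ _)).symm

lemma hermFun_congr {f g : ℝ → ℝ} {A : Matrix n n ℂ} (hA : A.PosSemidef)
    (hfg : ∀ x, 0 ≤ x → f x = g x) : hermFun f A = hermFun g A := by
  rw [hermFun_eq f hA.isHermitian, hermFun_eq g hA.isHermitian]
  simp only [hfg _ (hA.eigenvalues_nonneg _)]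

lemma hermFun_smul_arg (f : ℝ → ℝ) (c : ℝ) {A : Matrix n n ℂ} (hA : A.IsHermitian) :
    hermFun f (c • A) = hermFun (fun x => f (c * x)) A := by
  have h : c • A = hermFun (fun x => c * x) A := by
    rw [hermFun_eq_cfc _ hA]
    exact (cfc_const_mul_id c A hA).symm
  rw [h, hermFun_hermFun _ _ hA]

lemma hermFun_const_mul (f : ℝ → ℝ) (c : ℝ) {A : Matrix n n ℂ} (hA : A.IsHermitian) :
    hermFun (fun x => c * f x) A = c • hermFun f A := by
  rw [hermFun_eq_cfc _ hA, hermFun_eq_cfc _ hA]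
  exact cfc_const_mul c f A (continuousOn_spectrum_matrix _ _)

lemma posSemidef_hermFun {f : ℝ → ℝ} (hf : ∀ x, 0 ≤ x → 0 ≤ f x) {A : Matrix n n ℂ}
    (hA : A.PosSemidef) : (hermFun f A).PosSemidef := by
  rw [hermFun_eq f hA.isHermitian]
  refine (Matrix.PosSemidef.diagonal ?_).mul_mul_conjTranspose_same _
  intro i
  have := hf _ (hA.eigenvalues_nonneg i)
  simpa using this

/-- The squared moduli of the entries of `K` in eigenbases of `A` and `B`. -/
def eigWeight {A : Matrix n n ℂ} {B : Matrix m m ℂ} (hA : A.IsHermitian) (hB : B.IsHermitian)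
    (K : Matrix n m ℂ) (i : n) (j : m) : ℝ :=
  Complex.normSq ((star (hA.eigenvectorUnitary : Matrix n n ℂ) * K *
    (hB.eigenvectorUnitary : Matrix m m ℂ)) i j)

lemma trace_hermFun_sandwich (f g : ℝ → ℝ) {A : Matrix n n ℂ} {B : Matrix m m ℂ}
    (hA : A.IsHermitian) (hB : B.IsHermitian) (K : Matrix n m ℂ) :
    (Kᴴ * hermFun f A * K * hermFun g B).trace.re =
      ∑ i, ∑ j, eigWeight hA hB K i j * (f (hA.eigenvalues i) * g (hB.eigenvalues j)) := by
  rw [hermFun_eq f hA, hermFun_eq g hB]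
  set U := (hA.eigenvectorUnitary : Matrix n n ℂ)
  set V := (hB.eigenvectorUnitary : Matrix m m ℂ)
  set Df := Matrix.diagonal (fun i => (f (hA.eigenvalues i) : ℂ))
  set Dg := Matrix.diagonal (fun i => (g (hB.eigenvalues i) : ℂ))
  have h1 : (Kᴴ * (U * Df * star U) * K * (V * Dg * star V)).trace =
      ((star U * K * V)ᴴ * Df * (star U * K * V) * Dg).trace := by
    rw [show Kᴴ * (U * Df * star U) * K * (V * Dg * star V) =
      (Kᴴ * (U * Df * star U) * K * (V * Dg)) * star V by simp only [Matrix.mul_assoc]]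
    rw [Matrix.trace_mul_comm]
    simp only [Matrix.conjTranspose_mul, Matrix.star_eq_conjTranspose,
      Matrix.conjTranspose_conjTranspose, Matrix.mul_assoc]
  rw [h1]
  set L := star U * K * V with hL
  simp only [Matrix.trace, Matrix.diag_apply]
  have h2 : ∀ j, (Lᴴ * Df * L * Dg) j j =
      ∑ i, ((Complex.normSq (L i j) * (f (hA.eigenvalues i) * g (hB.eigenvalues j)) : ℝ) : ℂ) := by
    intro j
    rw [Matrix.mul_diagonal, Matrix.mul_apply, Finset.sum_mul]
    refine Finset.sum_congr rfl fun i _ => ?_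
    rw [Matrix.mul_diagonal, Matrix.conjTranspose_apply]
    push_cast
    rw [Complex.normSq_eq_conj_mul_self]
    simp only [RCLike.star_def]
    ring
  simp only [h2]
  rw [Finset.sum_comm]
  simp only [Complex.re_sum, Complex.ofReal_re]
  rfl

lemma eigWeight_nonneg {A : Matrix n n ℂ} {B : Matrix m m ℂ} (hA : A.IsHermitian)
    (hB : B.IsHermitian) (K : Matrix n m ℂ) (i : n) (j : m) : 0 ≤ eigWeight hA hB K i j :=
  Complex.normSq_nonneg _

/-- Functional calculus intertwines: `A W = W B` implies `f(A) W = W f(B)`. -/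
lemma hermFun_intertwine (f : ℝ → ℝ) {A : Matrix n n ℂ} {B : Matrix m m ℂ}
    (hA : A.IsHermitian) (hB : B.IsHermitian) {W : Matrix n m ℂ} (h : A * W = W * B) :
    hermFun f A * W = W * hermFun f B := by
  have hA' := hermFun_id hA
  have hB' := hermFun_id hB
  rw [hermFun_eq _ hA] at hA'
  rw [hermFun_eq _ hB] at hB'
  rw [hermFun_eq f hA, hermFun_eq f hB]
  have hU : star (hA.eigenvectorUnitary : Matrix n n ℂ) * (hA.eigenvectorUnitary : Matrix n n ℂ)
    = 1 := Unitary.coe_star_mul_self _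
  have hU' : (hA.eigenvectorUnitary : Matrix n n ℂ) * star (hA.eigenvectorUnitary : Matrix n n ℂ)
    = 1 := Unitary.coe_mul_star_self _
  have hV : star (hB.eigenvectorUnitary : Matrix m m ℂ) * (hB.eigenvectorUnitary : Matrix m m ℂ)
    = 1 := Unitary.coe_star_mul_self _
  have hV' : (hB.eigenvectorUnitary : Matrix m m ℂ) * star (hB.eigenvectorUnitary : Matrix m m ℂ)
    = 1 := Unitary.coe_mul_star_self _
  set U := (hA.eigenvectorUnitary : Matrix n n ℂ)
  set V := (hB.eigenvectorUnitary : Matrix m m ℂ)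
  set D : (ℝ → ℝ) → Matrix n n ℂ := fun f => Matrix.diagonal (fun i => (f (hA.eigenvalues i) : ℂ))
    with hD
  set D' : (ℝ → ℝ) → Matrix m m ℂ := fun f => Matrix.diagonal (fun i => (f (hB.eigenvalues i) : ℂ))
    with hD'
  change U * D f * star U * W = W * (V * D' f * star V)
  have key : D (fun x => x) * (star U * W * V) = (star U * W * V) * D' (fun x => x) := by
    calc D (fun x => x) * (star U * W * V)
        = star U * U * D (fun x => x) * (star U * W * V) := by rw [hU, Matrix.one_mul]
      _ = star U * ((U * D (fun x => x) * star U) * W) * V := by simp only [Matrix.mul_assoc]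
      _ = star U * (W * (V * D' (fun x => x) * star V)) * V := by
          change star U * ((U * Matrix.diagonal _ * star U) * W) * V =
            star U * (W * (V * Matrix.diagonal _ * star V)) * V
          rw [hA', hB', h]
      _ = (star U * W * V) * D' (fun x => x) * (star V * V) := by simp only [Matrix.mul_assoc]
      _ = _ := by rw [hV, Matrix.mul_one]
  have key2 : D f * (star U * W * V) = (star U * W * V) * D' f := by
    ext i j
    have := congrFun (congrFun key i) j
    simp only [hD, hD', Matrix.diagonal_mul, Matrix.mul_diagonal] at this ⊢
    by_cases h0 : (star U * W * V) i j = 0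
    · simp [h0]
    · rw [mul_comm, mul_right_inj' h0, Complex.ofReal_inj] at this
      rw [mul_comm, this]
  calc U * D f * star U * W = U * D f * star U * W * (V * star V) := by rw [hV', Matrix.mul_one]
    _ = U * (D f * (star U * W * V)) * star V := by simp only [Matrix.mul_assoc]
    _ = (U * star U) * W * (V * D' f * star V) := by rw [key2]; simp only [Matrix.mul_assoc]
    _ = _ := by rw [hU', Matrix.one_mul]

end SpectralCalculus

lemma re_trace_nonneg {n : Type} [Fintype n] {A : Matrix n n ℂ} (hA : A.PosSemidef) :
    0 ≤ A.trace.re :=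
  (Complex.le_def.1 hA.trace_nonneg).1

section MatrixPower

variable {n m : Type} [Fintype n] [DecidableEq n] [Fintype m] [DecidableEq m]

lemma matPow_eq_hermFun_rpow {A : Matrix n n ℂ} {r : ℝ} (hr : r ≠ 0) :
    matPow A r = hermFun (fun x => x ^ r) A := by
  unfold matPow
  congr 1
  ext x
  split_ifs with h
  · rw [h, Real.zero_rpow hr]
  · rfl

lemma matPow_mul_matPow {A : Matrix n n ℂ} (hA : A.PosSemidef) (r s : ℝ) :
    matPow A r * matPow A s = matPow A (r + s) := by
  unfold matPow
  rw [hermFun_mul _ _ hA.isHermitian]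
  refine hermFun_congr hA fun x hx => ?_
  rcases hx.eq_or_lt with rfl | hx
  · simp
  · simp only [hx.ne', if_false]
    exact (Real.rpow_add hx r s).symm

lemma matPow_one {A : Matrix n n ℂ} (hA : A.PosSemidef) : matPow A 1 = A := by
  rw [matPow_eq_hermFun_rpow one_ne_zero]
  simp only [Real.rpow_one]
  exact hermFun_id hA.isHermitian

lemma matPow_matPow {A : Matrix n n ℂ} (hA : A.PosSemidef) (r s : ℝ) :
    matPow (matPow A r) s = matPow A (r * s) := by
  unfold matPow
  rw [hermFun_hermFun _ _ hA.isHermitian]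
  refine hermFun_congr hA fun x hx => ?_
  rcases hx.eq_or_lt with rfl | hx
  · simp
  · have h1 : Real.rpow x r ≠ 0 := (Real.rpow_pos_of_pos hx r).ne'
    simp only [hx.ne', if_false, h1]
    exact (Real.rpow_mul hx.le r s).symm

lemma matPow_posSemidef {A : Matrix n n ℂ} (hA : A.PosSemidef) (r : ℝ) :
    (matPow A r).PosSemidef := by
  refine posSemidef_hermFun (fun x hx => ?_) hA
  split_ifs
  · exact le_rfl
  · exact Real.rpow_nonneg hx r

lemma matPow_conjTranspose (A : Matrix n n ℂ) (r : ℝ) : (matPow A r)ᴴ = matPow A r :=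
  isHermitian_hermFun _ _

lemma matPow_smul {A : Matrix n n ℂ} (hA : A.PosSemidef) {c : ℝ} (hc : 0 < c) (r : ℝ) :
    matPow (c • A) r = c ^ r • matPow A r := by
  unfold matPow
  rw [hermFun_smul_arg _ _ hA.isHermitian, ← hermFun_const_mul _ _ hA.isHermitian]
  refine hermFun_congr hA fun x hx => ?_
  rcases hx.eq_or_lt with rfl | hx
  · simp
  · simp only [hx.ne', (mul_pos hc hx).ne', if_false]
    exact Real.mul_rpow hc.le hx.le

/-- The real number `Tr A^r`. -/
def trPow (A : Matrix n n ℂ) (r : ℝ) : ℝ := (matPow A r).trace.re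

lemma trPow_nonneg {A : Matrix n n ℂ} (hA : A.PosSemidef) (r : ℝ) : 0 ≤ trPow A r :=
  re_trace_nonneg (matPow_posSemidef hA r)

lemma trPow_mul_conjTranspose (W : Matrix n m ℂ) (s : ℝ) :
    trPow (W * Wᴴ) s = trPow (Wᴴ * W) s := by
  have h1 : (W * Wᴴ).PosSemidef := Matrix.posSemidef_self_mul_conjTranspose W
  have h2 : (Wᴴ * W).PosSemidef := Matrix.posSemidef_conjTranspose_mul_self W
  have e1 : matPow (W * Wᴴ) s = matPow (W * Wᴴ) (s - 1) * (W * Wᴴ) := by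
    conv_rhs => rw [← matPow_one h1, matPow_matPow h1, one_mul, matPow_mul_matPow h1]
    rw [sub_add_cancel]
  have e2 : matPow (Wᴴ * W) s = matPow (Wᴴ * W) (s - 1) * (Wᴴ * W) := by
    conv_rhs => rw [← matPow_one h2, matPow_matPow h2, one_mul, matPow_mul_matPow h2]
    rw [sub_add_cancel]
  have e3 : matPow (W * Wᴴ) (s - 1) * W = W * matPow (Wᴴ * W) (s - 1) :=
    hermFun_intertwine _ h1.isHermitian h2.isHermitian (Matrix.mul_assoc _ _ _)
  unfold trPow
  rw [e1, e2, ← Matrix.mul_assoc, e3, Matrix.mul_assoc, Matrix.trace_mul_comm, Matrix.mul_assoc]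

/-- Hölder's inequality for the trace of a product of positive semidefinite matrices. -/
lemma trace_mul_le_trPow {X Y : Matrix n n ℂ} (hX : X.PosSemidef) (hY : Y.PosSemidef)
    {a b : ℝ} (hab : a.HolderConjugate b) :
    (X * Y).trace.re ≤ trPow X a ^ (1 / a) * trPow Y b ^ (1 / b) := by
  have ha : a ≠ 0 := hab.ne_zero
  have hb : b ≠ 0 := hab.symm.ne_zero
  set w : n × n → ℝ := fun q => eigWeight hX.isHermitian hY.isHermitian 1 q.1 q.2
  set x : n × n → ℝ := fun q => hX.isHermitian.eigenvalues q.1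
  set y : n × n → ℝ := fun q => hY.isHermitian.eigenvalues q.2
  have hw : ∀ q, 0 ≤ w q := fun q => eigWeight_nonneg _ _ _ _ _
  have hx : ∀ q, 0 ≤ x q := fun q => hX.eigenvalues_nonneg _
  have hy : ∀ q, 0 ≤ y q := fun q => hY.eigenvalues_nonneg _
  have key : ∀ f g : ℝ → ℝ, (hermFun f X * hermFun g Y).trace.re =
      ∑ q, w q * (f (x q) * g (y q)) := by
    intro f g
    have := trace_hermFun_sandwich f g hX.isHermitian hY.isHermitian 1
    rw [Matrix.conjTranspose_one, Matrix.one_mul, Matrix.mul_one] at this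
    rw [this, Fintype.sum_prod_type]
  have k1 := key (fun x => x) (fun x => x)
  rw [hermFun_id hX.isHermitian, hermFun_id hY.isHermitian] at k1
  have k2 := key (fun x => x ^ a) (fun _ => 1)
  rw [hermFun_one hY.isHermitian, Matrix.mul_one, ← matPow_eq_hermFun_rpow ha] at k2
  have k3 := key (fun _ => 1) (fun x => x ^ b)
  rw [hermFun_one hX.isHermitian, Matrix.one_mul, ← matPow_eq_hermFun_rpow hb] at k3
  have hsum : 1 / a + 1 / b = 1 := by
    simpa [one_div] using hab.inv_add_inv_eq_one
  have H := Real.inner_le_Lp_mul_Lq_of_nonneg Finset.univ hab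
    (f := fun q => w q ^ (1 / a) * x q) (g := fun q => w q ^ (1 / b) * y q)
    (fun q _ => mul_nonneg (Real.rpow_nonneg (hw q) _) (hx q))
    (fun q _ => mul_nonneg (Real.rpow_nonneg (hw q) _) (hy q))
  have hpow : ∀ (c : ℝ), c ≠ 0 → ∀ u v : ℝ, 0 ≤ u → 0 ≤ v →
      (u ^ (1 / c) * v) ^ c = u * v ^ c := by
    intro c hc u v hu hv
    rw [Real.mul_rpow (Real.rpow_nonneg hu _) hv, ← Real.rpow_mul hu, one_div_mul_cancel hc,
      Real.rpow_one]
  have e1 : ∑ q, w q ^ (1 / a) * x q * (w q ^ (1 / b) * y q) = (X * Y).trace.re := by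
    rw [k1]
    refine Finset.sum_congr rfl fun q _ => ?_
    have : w q ^ (1 / a) * w q ^ (1 / b) = w q := by
      rw [← Real.rpow_add_of_nonneg (hw q) (one_div_nonneg.2 hab.nonneg)
        (one_div_nonneg.2 hab.symm.nonneg), hsum, Real.rpow_one]
    calc _ = (w q ^ (1 / a) * w q ^ (1 / b)) * (x q * y q) := by ring
      _ = _ := by rw [this]
  have e2 : ∑ q, (w q ^ (1 / a) * x q) ^ a = trPow X a := by
    rw [trPow, k2]
    exact Finset.sum_congr rfl fun q _ => by rw [hpow a ha _ _ (hw q) (hx q), mul_one]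
  have e3 : ∑ q, (w q ^ (1 / b) * y q) ^ b = trPow Y b := by
    rw [trPow, k3]
    exact Finset.sum_congr rfl fun q _ => by rw [hpow b hb _ _ (hw q) (hy q), one_mul]
  rwa [e1, e2, e3] at H

end MatrixPower

section LiebConcavity

variable {n m n' m' : Type} [Fintype n] [DecidableEq n] [Fintype m] [DecidableEq m]
  [Fintype n'] [DecidableEq n'] [Fintype m'] [DecidableEq m']

lemma trace_conjTranspose_mul_mul {A : Matrix n n ℂ} {B : Matrix m m ℂ} (hA : A.IsHermitian)
    (hB : B.IsHermitian) (u : Matrix n m ℂ) :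
    (uᴴ * A * u).trace.re = ∑ i, ∑ j, eigWeight hA hB u i j * hA.eigenvalues i := by
  have := trace_hermFun_sandwich (fun x => x) (fun _ => 1) hA hB u
  rw [hermFun_id hA, hermFun_one hB, Matrix.mul_one] at this
  simpa using this

lemma trace_mul_mul_conjTranspose {A : Matrix n n ℂ} {B : Matrix m m ℂ} (hA : A.IsHermitian)
    (hB : B.IsHermitian) (u : Matrix n m ℂ) :
    (u * B * uᴴ).trace.re = ∑ i, ∑ j, eigWeight hA hB u i j * hB.eigenvalues j := by
  have := trace_hermFun_sandwich (fun _ => 1) (fun x => x) hA hB u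
  rw [hermFun_id hB, hermFun_one hA, Matrix.mul_one] at this
  rw [Matrix.trace_mul_comm, ← Matrix.mul_assoc, this]
  simp

lemma parallel_le (a b t : ℝ) (ha : 0 ≤ a) (hb : 0 ≤ b) (ht : 0 < t) (u v : ℂ) :
    Complex.normSq (u + v) * (t * (a * b / (a + t * b))) ≤
      Complex.normSq u * a + t * (Complex.normSq v * b) := by
  have hu := Complex.normSq_nonneg u
  have hv := Complex.normSq_nonneg v
  have htb : 0 ≤ t * b := mul_nonneg ht.le hb
  rcases (add_nonneg ha htb).eq_or_lt with h | h
  · rw [← h]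
    simp only [div_zero, mul_zero]
    positivity
  · rw [← mul_div_assoc, ← mul_div_assoc, div_le_iff₀ h]
    simp only [Complex.normSq_apply, Complex.add_re, Complex.add_im]
    nlinarith [sq_nonneg (a * u.re - t * b * v.re), sq_nonneg (a * u.im - t * b * v.im)]

lemma parallel_eq (a b t : ℝ) (ha : 0 ≤ a) (hb : 0 ≤ b) (ht : 0 < t) :
    (t * b / (a + t * b)) ^ 2 * a + t * ((1 - t * b / (a + t * b)) ^ 2 * b) =
      t * (a * b / (a + t * b)) := by
  have htb : 0 ≤ t * b := mul_nonneg ht.le hb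
  rcases (add_nonneg ha htb).eq_or_lt with h | h
  · have h1 : a = 0 := by linarith
    have h2 : t * b = 0 := by linarith
    have h3 : b = 0 := by simpa [ht.ne'] using h2
    simp [h1, h3]
  · field_simp
    ring

lemma integrand_eq (p a b t : ℝ) (ha : 0 ≤ a) (hb : 0 ≤ b) (ht : 0 < t) :
    b * Real.rpowIntegrand₀₁ p t (a / b) = t ^ p * t⁻¹ * (a * b / (a + t * b)) := by
  rcases hb.eq_or_lt with rfl | hb
  · simp
  · have : a + t * b ≠ 0 := by positivity
    have : t + a / b ≠ 0 := by positivity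
    have : b * t + a ≠ 0 := by positivity
    unfold Real.rpowIntegrand₀₁
    field_simp
    ring

/-- A sum of parallel means is dominated as soon as every splitting of `K'` can be transferred
to a splitting of `K` of smaller cost. -/
lemma sum_parallel_le {A : Matrix n n ℂ} {B : Matrix m m ℂ} {A' : Matrix n' n' ℂ}
    {B' : Matrix m' m' ℂ} (hA : A.PosSemidef) (hB : B.PosSemidef) (hA' : A'.PosSemidef)
    (hB' : B'.PosSemidef) (K : Matrix n m ℂ) (K' : Matrix n' m' ℂ)
    (H : ∀ u v : Matrix n' m' ℂ, u + v = K' → ∃ U V : Matrix n m ℂ, U + V = K ∧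
      (Uᴴ * A * U).trace.re ≤ (uᴴ * A' * u).trace.re ∧
      (V * B * Vᴴ).trace.re ≤ (v * B' * vᴴ).trace.re) (t : ℝ) (ht : 0 < t) :
    ∑ i, ∑ j, eigWeight hA.isHermitian hB.isHermitian K i j *
        (hA.isHermitian.eigenvalues i * hB.isHermitian.eigenvalues j /
          (hA.isHermitian.eigenvalues i + t * hB.isHermitian.eigenvalues j)) ≤
    ∑ i, ∑ j, eigWeight hA'.isHermitian hB'.isHermitian K' i j *
        (hA'.isHermitian.eigenvalues i * hB'.isHermitian.eigenvalues j /
          (hA'.isHermitian.eigenvalues i + t * hB'.isHermitian.eigenvalues j)) := by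
  set a := hA.isHermitian.eigenvalues with ha_def
  set b := hB.isHermitian.eigenvalues with hb_def
  set a' := hA'.isHermitian.eigenvalues with ha'_def
  set b' := hB'.isHermitian.eigenvalues with hb'_def
  have ha : ∀ i, 0 ≤ a i := hA.eigenvalues_nonneg
  have hb : ∀ i, 0 ≤ b i := hB.eigenvalues_nonneg
  have ha' : ∀ i, 0 ≤ a' i := hA'.eigenvalues_nonneg
  have hb' : ∀ i, 0 ≤ b' i := hB'.eigenvalues_nonneg
  set P := (hA'.isHermitian.eigenvectorUnitary : Matrix n' n' ℂ)
  set Q := (hB'.isHermitian.eigenvectorUnitary : Matrix m' m' ℂ)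
  have hP : star P * P = 1 := Unitary.coe_star_mul_self _
  have hP' : P * star P = 1 := Unitary.coe_mul_star_self _
  have hQ : star Q * Q = 1 := Unitary.coe_star_mul_self _
  have hQ' : Q * star Q = 1 := Unitary.coe_mul_star_self _
  set L := star P * K' * Q with hL
  set c : n' → m' → ℝ := fun i j => t * b' j / (a' i + t * b' j) with hc
  set Lu : Matrix n' m' ℂ := Matrix.of fun i j => (c i j : ℂ) * L i j with hLu
  set Lv : Matrix n' m' ℂ := Matrix.of fun i j => ((1 - c i j : ℝ) : ℂ) * L i j with hLv
  have hrot : ∀ X : Matrix n' m' ℂ, star P * (P * X * star Q) * Q = X := by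
    intro X
    calc star P * (P * X * star Q) * Q = (star P * P) * X * (star Q * Q) := by
          simp only [Matrix.mul_assoc]
      _ = X := by rw [hP, hQ, Matrix.one_mul, Matrix.mul_one]
  have huv : P * Lu * star Q + P * Lv * star Q = K' := by
    rw [← Matrix.add_mul, ← Matrix.mul_add]
    have : Lu + Lv = L := by
      ext i j
      simp only [hLu, hLv, Matrix.add_apply, Matrix.of_apply]
      push_cast
      ring
    rw [this, hL]
    calc P * (star P * K' * Q) * star Q = (P * star P) * K' * (Q * star Q) := by
          simp only [Matrix.mul_assoc]
      _ = K' := by rw [hP', hQ', Matrix.one_mul, Matrix.mul_one]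
  obtain ⟨U, V, hUV, h1, h2⟩ := H _ _ huv
  rw [trace_conjTranspose_mul_mul hA.isHermitian hB.isHermitian,
    trace_conjTranspose_mul_mul hA'.isHermitian hB'.isHermitian] at h1
  rw [trace_mul_mul_conjTranspose hA.isHermitian hB.isHermitian,
    trace_mul_mul_conjTranspose hA'.isHermitian hB'.isHermitian] at h2
  have hwu : ∀ i j, eigWeight hA'.isHermitian hB'.isHermitian (P * Lu * star Q) i j =
      (c i j) ^ 2 * Complex.normSq (L i j) := by
    intro i j
    change Complex.normSq ((star P * (P * Lu * star Q) * Q) i j) = _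
    rw [hrot, hLu, Matrix.of_apply, Complex.normSq_mul, Complex.normSq_ofReal, sq]
  have hwv : ∀ i j, eigWeight hA'.isHermitian hB'.isHermitian (P * Lv * star Q) i j =
      (1 - c i j) ^ 2 * Complex.normSq (L i j) := by
    intro i j
    change Complex.normSq ((star P * (P * Lv * star Q) * Q) i j) = _
    rw [hrot, hLv, Matrix.of_apply, Complex.normSq_mul, Complex.normSq_ofReal, sq]
  simp only [hwu] at h1
  simp only [hwv] at h2
  have hlow : ∑ i, ∑ j, eigWeight hA.isHermitian hB.isHermitian K i j *
      (t * (a i * b j / (a i + t * b j))) ≤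
      ∑ i, ∑ j, eigWeight hA.isHermitian hB.isHermitian U i j * a i +
      t * ∑ i, ∑ j, eigWeight hA.isHermitian hB.isHermitian V i j * b j := by
    simp only [Finset.mul_sum, ← Finset.sum_add_distrib]
    refine Finset.sum_le_sum fun i _ => Finset.sum_le_sum fun j _ => ?_
    have := parallel_le (a i) (b j) t (ha i) (hb j) ht
      ((star (hA.isHermitian.eigenvectorUnitary : Matrix n n ℂ) * U *
        (hB.isHermitian.eigenvectorUnitary : Matrix m m ℂ)) i j)
      ((star (hA.isHermitian.eigenvectorUnitary : Matrix n n ℂ) * V *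
        (hB.isHermitian.eigenvectorUnitary : Matrix m m ℂ)) i j)
    rw [← Matrix.add_apply, ← Matrix.add_mul, ← Matrix.mul_add, hUV] at this
    exact this
  have hup : ∑ i, ∑ j, c i j ^ 2 * Complex.normSq (L i j) * a' i +
      t * ∑ i, ∑ j, (1 - c i j) ^ 2 * Complex.normSq (L i j) * b' j =
      ∑ i, ∑ j, eigWeight hA'.isHermitian hB'.isHermitian K' i j *
        (t * (a' i * b' j / (a' i + t * b' j))) := by
    simp only [Finset.mul_sum, ← Finset.sum_add_distrib]
    refine Finset.sum_congr rfl fun i _ => Finset.sum_congr rfl fun j _ => ?_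
    rw [← parallel_eq (a' i) (b' j) t (ha' i) (hb' j) ht]
    change _ = Complex.normSq (L i j) * _
    ring
  have hfin := hlow.trans ((add_le_add h1 (mul_le_mul_of_nonneg_left h2 ht.le)).trans hup.le)
  have hscale : ∀ {ν μ : Type} [Fintype ν] [Fintype μ] (w f : ν → μ → ℝ),
      ∑ i, ∑ j, w i j * (t * f i j) = t * ∑ i, ∑ j, w i j * f i j := by
    intro ν μ _ _ w f
    simp only [Finset.mul_sum]
    exact Finset.sum_congr rfl fun i _ => Finset.sum_congr rfl fun j _ => by ring
  rw [hscale _ (fun i j => a i * b j / (a i + t * b j)),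
    hscale _ (fun i j => a' i * b' j / (a' i + t * b' j))] at hfin
  exact le_of_mul_le_mul_left hfin ht

lemma rpow_mul_rpow_eq_integral {p : ℝ} (hp : p ∈ Set.Ioo (0 : ℝ) 1) {a b : ℝ} (ha : 0 ≤ a)
    (hb : 0 ≤ b) :
    a ^ p * b ^ (1 - p) * (∫ t in Set.Ioi 0, Real.rpowIntegrand₀₁ p t 1) =
      ∫ t in Set.Ioi 0, b * Real.rpowIntegrand₀₁ p t (a / b) := by
  rw [MeasureTheory.integral_const_mul,
    Real.integral_rpowIntegrand₀₁_eq_rpow_mul_const hp (div_nonneg ha hb), ← mul_assoc]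
  congr 1
  rcases hb.eq_or_lt with rfl | hb
  · rw [Real.zero_rpow (by linarith [hp.2]), mul_zero, zero_mul]
  · rw [Real.div_rpow ha hb.le, Real.rpow_sub hb, Real.rpow_one]
    ring

/-- Monotonicity of `Tr[K* A^p K B^(1-p)]` under transfer of splittings (Lieb's concavity). -/
lemma lieb_monotone {A : Matrix n n ℂ} {B : Matrix m m ℂ} {A' : Matrix n' n' ℂ}
    {B' : Matrix m' m' ℂ} (hA : A.PosSemidef) (hB : B.PosSemidef) (hA' : A'.PosSemidef)
    (hB' : B'.PosSemidef) (K : Matrix n m ℂ) (K' : Matrix n' m' ℂ)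
    (H : ∀ u v : Matrix n' m' ℂ, u + v = K' → ∃ U V : Matrix n m ℂ, U + V = K ∧
      (Uᴴ * A * U).trace.re ≤ (uᴴ * A' * u).trace.re ∧
      (V * B * Vᴴ).trace.re ≤ (v * B' * vᴴ).trace.re) {p : ℝ} (hp : p ∈ Set.Ioo (0 : ℝ) 1) :
    (Kᴴ * matPow A p * K * matPow B (1 - p)).trace.re ≤
      (K'ᴴ * matPow A' p * K' * matPow B' (1 - p)).trace.re := by
  have hp0 : p ≠ 0 := hp.1.ne'
  have hp1 : 1 - p ≠ 0 := by linarith [hp.2]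
  have hC := Real.integral_rpowIntegrand₀₁_one_pos hp
  set C := ∫ t in Set.Ioi 0, Real.rpowIntegrand₀₁ p t 1
  have rep : ∀ {ν μ : Type} [Fintype ν] [DecidableEq ν] [Fintype μ] [DecidableEq μ]
      {X : Matrix ν ν ℂ} {Y : Matrix μ μ ℂ} (hX : X.PosSemidef) (hY : Y.PosSemidef)
      (L : Matrix ν μ ℂ),
      MeasureTheory.IntegrableOn (fun t => ∑ i, ∑ j, eigWeight hX.isHermitian hY.isHermitian L i j *
        (hY.isHermitian.eigenvalues j * Real.rpowIntegrand₀₁ p t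
          (hX.isHermitian.eigenvalues i / hY.isHermitian.eigenvalues j))) (Set.Ioi 0) ∧
      (Lᴴ * matPow X p * L * matPow Y (1 - p)).trace.re * C =
        ∫ t in Set.Ioi 0, ∑ i, ∑ j, eigWeight hX.isHermitian hY.isHermitian L i j *
        (hY.isHermitian.eigenvalues j * Real.rpowIntegrand₀₁ p t
          (hX.isHermitian.eigenvalues i / hY.isHermitian.eigenvalues j)) := by
    intro ν μ _ _ _ _ X Y hX hY L
    have hint : ∀ i j, MeasureTheory.IntegrableOn
        (fun t => eigWeight hX.isHermitian hY.isHermitian L i j *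
        (hY.isHermitian.eigenvalues j * Real.rpowIntegrand₀₁ p t
          (hX.isHermitian.eigenvalues i / hY.isHermitian.eigenvalues j))) (Set.Ioi 0) :=
      fun i j => ((Real.integrableOn_rpowIntegrand₀₁_Ioi hp
        (div_nonneg (hX.eigenvalues_nonneg i) (hY.eigenvalues_nonneg j))).const_mul _).const_mul _
    refine ⟨MeasureTheory.integrable_finsetSum _ fun i _ =>
      MeasureTheory.integrable_finsetSum _ fun j _ => hint i j, ?_⟩
    rw [matPow_eq_hermFun_rpow hp0, matPow_eq_hermFun_rpow hp1,
      trace_hermFun_sandwich _ _ hX.isHermitian hY.isHermitian,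
      MeasureTheory.integral_finsetSum _ fun i _ =>
        MeasureTheory.integrable_finsetSum _ fun j _ => hint i j, Finset.sum_mul]
    refine Finset.sum_congr rfl fun i _ => ?_
    rw [MeasureTheory.integral_finsetSum _ fun j _ => hint i j, Finset.sum_mul]
    refine Finset.sum_congr rfl fun j _ => ?_
    rw [MeasureTheory.integral_const_mul, ← rpow_mul_rpow_eq_integral hp
      (hX.eigenvalues_nonneg i) (hY.eigenvalues_nonneg j), mul_assoc]
  obtain ⟨i1, e1⟩ := rep hA hB K
  obtain ⟨i2, e2⟩ := rep hA' hB' K'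
  refine le_of_mul_le_mul_right ?_ hC
  rw [e1, e2]
  refine MeasureTheory.setIntegral_mono_on i1 i2 measurableSet_Ioi fun t ht => ?_
  have ht : 0 < t := ht
  simp only [integrand_eq p _ _ t (hA.eigenvalues_nonneg _) (hB.eigenvalues_nonneg _) ht,
    integrand_eq p _ _ t (hA'.eigenvalues_nonneg _) (hB'.eigenvalues_nonneg _) ht]
  have hscale : ∀ {ν μ : Type} [Fintype ν] [Fintype μ] (s : ℝ) (w f : ν → μ → ℝ),
      ∑ i, ∑ j, w i j * (s * f i j) = s * ∑ i, ∑ j, w i j * f i j := by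
    intro ν μ _ _ s w f
    simp only [Finset.mul_sum]
    exact Finset.sum_congr rfl fun i _ => Finset.sum_congr rfl fun j _ => by ring
  rw [hscale, hscale]
  exact mul_le_mul_of_nonneg_left (sum_parallel_le hA hB hA' hB' K K' H t ht) (by positivity)

end LiebConcavity

open Kronecker

lemma re_trace_mul_nonneg {n : Type} [Fintype n] {P Q : Matrix n n ℂ} (hP : P.PosSemidef)
    (hQ : Q.PosSemidef) : 0 ≤ (P * Q).trace.re := by
  have h : P = matPow P (1 / 2) * matPow P (1 / 2) := by
    rw [matPow_mul_matPow hP, add_halves, matPow_one hP]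
  rw [h, Matrix.mul_assoc, Matrix.trace_mul_comm]
  have := hQ.mul_mul_conjTranspose_same (matPow P (1 / 2))
  rw [matPow_conjTranspose] at this
  exact re_trace_nonneg this

lemma re_trace_mul_mono {n : Type} [Fintype n] {P A B : Matrix n n ℂ} (hP : P.PosSemidef)
    (h : (B - A).PosSemidef) : (A * P).trace.re ≤ (B * P).trace.re := by
  have := re_trace_mul_nonneg h hP
  rw [Matrix.sub_mul, Matrix.trace_sub, Complex.sub_re] at this
  linarith

lemma le_of_le_rpow_mul_rpow {x y p : ℝ} (hx : 0 ≤ x) (hy : 0 ≤ y) (hp : 0 < p)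
    (h : x ≤ y ^ p * x ^ (1 - p)) : x ≤ y := by
  rcases hx.eq_or_lt with rfl | hx
  · exact hy
  · have h1 : x ^ p * x ^ (1 - p) ≤ y ^ p * x ^ (1 - p) := by
      rwa [← Real.rpow_add hx, add_sub_cancel, Real.rpow_one]
    exact (Real.rpow_le_rpow_iff hx.le hy hp).1
      (le_of_mul_le_mul_right h1 (Real.rpow_pos_of_pos hx _))

section Dilation

variable {ι κ E : Type} [Fintype ι] [Fintype κ] [Fintype E]

/-- Partial trace over the right tensor factor. -/
def ptraceRight (X : Matrix (κ × E) (κ × E) ℂ) : Matrix κ κ ℂ :=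
  fun b b' => ∑ e, X (b, e) (b', e)

/-- The completely positive map `X ↦ Tr_E (V X V*)`. -/
def dilate (V : Matrix (κ × E) ι ℂ) (X : Matrix ι ι ℂ) : Matrix κ κ ℂ :=
  ptraceRight (V * X * Vᴴ)

lemma trace_ptraceRight (X : Matrix (κ × E) (κ × E) ℂ) : (ptraceRight X).trace = X.trace := by
  simp only [Matrix.trace, Matrix.diag_apply, ptraceRight, Fintype.sum_prod_type]

lemma posSemidef_ptraceRight {κ E : Type} [Fintype E] {X : Matrix (κ × E) (κ × E) ℂ}
    (hX : X.PosSemidef) :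
    (ptraceRight X).PosSemidef := by
  have : ptraceRight X = ∑ e, X.submatrix (fun b => (b, e)) (fun b => (b, e)) := by
    ext b b'
    simp [ptraceRight, Matrix.sum_apply]
  rw [this]
  exact Matrix.posSemidef_sum _ fun e _ => hX.submatrix _

lemma posSemidef_dilate (V : Matrix (κ × E) ι ℂ) {X : Matrix ι ι ℂ} (hX : X.PosSemidef) :
    (dilate V X).PosSemidef :=
  posSemidef_ptraceRight (hX.mul_mul_conjTranspose_same V)

lemma trace_ptraceRight_mul [DecidableEq E] (X : Matrix (κ × E) (κ × E) ℂ) (h : Matrix κ κ ℂ) :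
    (ptraceRight X * h).trace = (X * (h ⊗ₖ (1 : Matrix E E ℂ))).trace := by
  simp only [Matrix.trace, Matrix.diag_apply, Matrix.mul_apply, ptraceRight,
    Fintype.sum_prod_type, Matrix.kroneckerMap_apply, Matrix.one_apply, Finset.sum_mul]
  refine Finset.sum_congr rfl fun b _ => ?_
  rw [Finset.sum_comm]
  refine Finset.sum_congr rfl fun e _ => Finset.sum_congr rfl fun b' _ => ?_
  simp

lemma trace_dilate_mul [DecidableEq E] (V : Matrix (κ × E) ι ℂ) (X : Matrix ι ι ℂ)
    (h : Matrix κ κ ℂ) :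
    (dilate V X * h).trace = (X * (Vᴴ * (h ⊗ₖ (1 : Matrix E E ℂ)) * V)).trace := by
  rw [dilate, trace_ptraceRight_mul, Matrix.mul_assoc, Matrix.mul_assoc, Matrix.trace_mul_comm]
  simp only [Matrix.mul_assoc]

variable [DecidableEq ι] [DecidableEq κ] [DecidableEq E]

lemma trPow_dual_le {V : Matrix (κ × E) ι ℂ} (hV : (1 - V * Vᴴ).PosSemidef)
    {σ : Matrix ι ι ℂ} {τ H : Matrix κ κ ℂ} (hσ : σ.PosSemidef) (hτ : τ.PosSemidef)
    (hH : H.PosSemidef) (hle : (τ - dilate V σ).PosSemidef) {p s : ℝ} (hs : 1 < s)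
    (hp : p = 1 / s) :
    trPow (matPow σ (p / 2) * (Vᴴ * (H ⊗ₖ (1 : Matrix E E ℂ)) * V) * matPow σ (p / 2)) s ≤
      trPow (matPow τ (p / 2) * H * matPow τ (p / 2)) s := by
  have hs0 : 0 < s := by linarith
  have hp0 : 0 < p := by rw [hp]; positivity
  have hp1 : p < 1 := by rw [hp, div_lt_one hs0]; exact hs
  have hps : s * (1 - p) = s - 1 := by rw [hp]; field_simp
  obtain ⟨h, hhs, hhh⟩ : ∃ h : Matrix κ κ ℂ, hᴴ = h ∧ h * h = H :=
    ⟨matPow H (1 / 2), matPow_conjTranspose _ _,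
      by rw [matPow_mul_matPow hH, add_halves, matPow_one hH]⟩
  set k : Matrix ι (κ × E) ℂ := Vᴴ * (h ⊗ₖ (1 : Matrix E E ℂ)) with hk
  have hkk : k * kᴴ = Vᴴ * (H ⊗ₖ (1 : Matrix E E ℂ)) * V := by
    rw [hk, Matrix.conjTranspose_mul, Matrix.conjTranspose_conjTranspose,
      Matrix.conjTranspose_kronecker, hhs, Matrix.conjTranspose_one]
    calc _ = Vᴴ * ((h ⊗ₖ (1 : Matrix E E ℂ)) * (h ⊗ₖ (1 : Matrix E E ℂ))) * V := by
          simp only [Matrix.mul_assoc]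
      _ = _ := by rw [← Matrix.mul_kronecker_mul, hhh, Matrix.one_mul]
  have half : ∀ {ν : Type} [Fintype ν] [DecidableEq ν] {A : Matrix ν ν ℂ}, A.PosSemidef →
      matPow A (p / 2) * matPow A (p / 2) = matPow A p := by
    intro ν _ _ A hA
    rw [matPow_mul_matPow hA, add_halves]
  have e1 : matPow σ (p / 2) * (Vᴴ * (H ⊗ₖ (1 : Matrix E E ℂ)) * V) * matPow σ (p / 2) =
      (matPow σ (p / 2) * k) * (matPow σ (p / 2) * k)ᴴ := by
    rw [Matrix.conjTranspose_mul, matPow_conjTranspose, ← hkk]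
    simp only [Matrix.mul_assoc]
  have e2 : (matPow σ (p / 2) * k)ᴴ * (matPow σ (p / 2) * k) = kᴴ * matPow σ p * k := by
    rw [Matrix.conjTranspose_mul, matPow_conjTranspose, ← half hσ]
    simp only [Matrix.mul_assoc]
  have e3 : matPow τ (p / 2) * H * matPow τ (p / 2) =
      (matPow τ (p / 2) * h) * (matPow τ (p / 2) * h)ᴴ := by
    rw [Matrix.conjTranspose_mul, matPow_conjTranspose, hhs, ← hhh]
    simp only [Matrix.mul_assoc]
  have e4 : (matPow τ (p / 2) * h)ᴴ * (matPow τ (p / 2) * h) = hᴴ * matPow τ p * h := by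
    rw [Matrix.conjTranspose_mul, matPow_conjTranspose, ← half hτ]
    simp only [Matrix.mul_assoc]
  rw [e1, e3, trPow_mul_conjTranspose, trPow_mul_conjTranspose, e2, e4]
  set G := kᴴ * matPow σ p * k with hG
  set G' := hᴴ * matPow τ p * h with hG'
  have pG : G.PosSemidef := (matPow_posSemidef hσ p).conjTranspose_mul_mul_same k
  have pG' : G'.PosSemidef := (matPow_posSemidef hτ p).conjTranspose_mul_mul_same h
  set Z := matPow G s with hZ
  have pZ : Z.PosSemidef := matPow_posSemidef pG s
  have pZB : (ptraceRight Z).PosSemidef := posSemidef_ptraceRight pZ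
  have hGZ : (G * matPow Z (1 - p)).trace.re = trPow G s := by
    rw [hZ, matPow_matPow pG, hps, trPow]
    conv_lhs => rw [← matPow_one pG, matPow_matPow pG, one_mul, matPow_mul_matPow pG]
    rw [add_sub_cancel]
  have lieb := lieb_monotone hσ pZ hτ pZB k h (p := p) (by
    intro u v huv
    refine ⟨Vᴴ * (u ⊗ₖ (1 : Matrix E E ℂ)), Vᴴ * (v ⊗ₖ (1 : Matrix E E ℂ)), ?_, ?_, ?_⟩
    · rw [← Matrix.mul_add, ← Matrix.add_kronecker, huv]
    · have hl : ((Vᴴ * (u ⊗ₖ (1 : Matrix E E ℂ)))ᴴ * σ * (Vᴴ * (u ⊗ₖ (1 : Matrix E E ℂ)))).trace =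
          (dilate V σ * (u * uᴴ)).trace := by
        rw [trace_dilate_mul, Matrix.mul_assoc, Matrix.trace_mul_comm, Matrix.mul_assoc,
          Matrix.conjTranspose_mul, Matrix.conjTranspose_conjTranspose,
          Matrix.conjTranspose_kronecker, Matrix.conjTranspose_one]
        congr 2
        calc _ = Vᴴ * ((u ⊗ₖ (1 : Matrix E E ℂ)) * (uᴴ ⊗ₖ (1 : Matrix E E ℂ))) * V := by
              simp only [Matrix.mul_assoc]
          _ = _ := by rw [← Matrix.mul_kronecker_mul, Matrix.one_mul]
      have hr : (uᴴ * τ * u).trace = (τ * (u * uᴴ)).trace := by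
        rw [Matrix.mul_assoc, Matrix.trace_mul_comm, Matrix.mul_assoc]
      rw [hl, hr]
      exact re_trace_mul_mono (Matrix.posSemidef_self_mul_conjTranspose u) hle
    · have hl : (Vᴴ * (v ⊗ₖ (1 : Matrix E E ℂ)) * Z * (Vᴴ * (v ⊗ₖ (1 : Matrix E E ℂ)))ᴴ).trace =
          ((V * Vᴴ) * ((v ⊗ₖ (1 : Matrix E E ℂ)) * Z * (v ⊗ₖ (1 : Matrix E E ℂ))ᴴ)).trace := by
        rw [Matrix.conjTranspose_mul, Matrix.conjTranspose_conjTranspose, ← Matrix.mul_assoc,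
          Matrix.trace_mul_comm]
        simp only [Matrix.mul_assoc]
      have hr : (v * ptraceRight Z * vᴴ).trace =
          (1 * ((v ⊗ₖ (1 : Matrix E E ℂ)) * Z * (v ⊗ₖ (1 : Matrix E E ℂ))ᴴ)).trace := by
        rw [Matrix.one_mul, Matrix.mul_assoc, Matrix.trace_mul_comm, Matrix.mul_assoc,
          trace_ptraceRight_mul, Matrix.mul_assoc, Matrix.trace_mul_comm (v ⊗ₖ 1),
          Matrix.mul_assoc, Matrix.conjTranspose_kronecker, Matrix.conjTranspose_one,
          ← Matrix.mul_kronecker_mul, Matrix.one_mul]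
      rw [hl, hr]
      exact re_trace_mul_mono (pZ.mul_mul_conjTranspose_same _) hV) ⟨hp0, hp1⟩
  rw [← hG, ← hG', hGZ] at lieb
  have hconj : s.HolderConjugate (1 / (1 - p)) := by
    have := Real.HolderConjugate.conjExponent hs
    rw [Real.conjExponent, ← hps] at this
    convert this using 1
    field_simp
  have hold := trace_mul_le_trPow pG' (matPow_posSemidef pZB (1 - p)) hconj
  have hB : trPow (matPow (ptraceRight Z) (1 - p)) (1 / (1 - p)) = trPow G s := by
    rw [trPow, matPow_matPow pZB, mul_one_div_cancel (by linarith), matPow_one pZB,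
      trace_ptraceRight, trPow]
  rw [hB, one_div_one_div, ← hp] at hold
  exact le_of_le_rpow_mul_rpow (trPow_nonneg pG s) (trPow_nonneg pG' s) hp0 (lieb.trans hold)

end Dilation

section Renyi

variable {n : Type} [Fintype n] [DecidableEq n]

/-- The trace functional inside the sandwiched Rényi divergence. -/
def sandTrace (α : ℝ) (ρ σ : Matrix n n ℂ) : ℝ :=
  trPow (matPow σ ((1 - α) / (2 * α)) * ρ * matPow σ ((1 - α) / (2 * α))) α

lemma posSemidef_matPow_sandwich {ρ : Matrix n n ℂ} (σ : Matrix n n ℂ) (hρ : ρ.PosSemidef)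
    (r : ℝ) : (matPow σ r * ρ * matPow σ r).PosSemidef := by
  have := hρ.mul_mul_conjTranspose_same (matPow σ r)
  rwa [matPow_conjTranspose] at this

lemma sandTrace_nonneg (α : ℝ) {ρ : Matrix n n ℂ} (σ : Matrix n n ℂ) (hρ : ρ.PosSemidef) :
    0 ≤ sandTrace α ρ σ :=
  trPow_nonneg (posSemidef_matPow_sandwich σ hρ _) α

lemma suppLE.mul_matPow_zero {ρ σ : Matrix n n ℂ} (h : suppLE ρ σ) (hσ : σ.PosSemidef) :
    ρ * matPow σ 0 = ρ := by
  have h0 : σ * (1 - matPow σ 0) = 0 := by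
    rw [Matrix.mul_sub, Matrix.mul_one]
    conv_lhs => enter [2, 1]; rw [← matPow_one hσ]
    rw [matPow_mul_matPow hσ, add_zero, matPow_one hσ, sub_self]
  have h1 : ρ * (1 - matPow σ 0) = 0 := by
    ext i j
    have hc : σ.mulVec (fun l => (1 - matPow σ 0) l j) = 0 := by
      ext i'
      exact congrFun (congrFun h0 i') j
    exact congrFun (h _ hc) i
  rw [Matrix.mul_sub, Matrix.mul_one, sub_eq_zero] at h1
  exact h1.symm

lemma suppLE.matPow_zero_mul {ρ σ : Matrix n n ℂ} (h : suppLE ρ σ) (hρ : ρ.PosSemidef)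
    (hσ : σ.PosSemidef) : matPow σ 0 * ρ = ρ := by
  have := congrArg Matrix.conjTranspose (h.mul_matPow_zero hσ)
  rwa [Matrix.conjTranspose_mul, matPow_conjTranspose, hρ.isHermitian.eq] at this

lemma re_trace_mul_le_sandTrace {ρ σ H : Matrix n n ℂ} (hρ : ρ.PosSemidef) (hσ : σ.PosSemidef)
    (hH : H.PosSemidef) (h : suppLE ρ σ) {α : ℝ} (hα : 1 < α) :
    (ρ * H).trace.re ≤ sandTrace α ρ σ ^ (1 / α) *
      trPow (matPow σ ((α - 1) / α / 2) * H * matPow σ ((α - 1) / α / 2)) (α / (α - 1)) ^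
        ((α - 1) / α) := by
  have hexp : (1 - α) / (2 * α) = -((α - 1) / α / 2) := by
    field_simp
    ring
  set q := (α - 1) / α / 2 with hq
  have hconj : α.HolderConjugate (α / (α - 1)) := Real.HolderConjugate.conjExponent hα
  have hold := trace_mul_le_trPow (posSemidef_matPow_sandwich σ hρ (-q))
    (posSemidef_matPow_sandwich σ hH q) hconj
  rw [one_div_div] at hold
  unfold sandTrace
  rw [hexp]
  refine le_of_eq_of_le ?_ hold
  congr 1
  have e1 : matPow σ (-q) * matPow σ q = matPow σ 0 := by
    rw [matPow_mul_matPow hσ, neg_add_cancel]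
  have e2 : matPow σ q * matPow σ (-q) = matPow σ 0 := by
    rw [matPow_mul_matPow hσ, add_neg_cancel]
  symm
  calc (matPow σ (-q) * ρ * matPow σ (-q) * (matPow σ q * H * matPow σ q)).trace
      = (matPow σ (-q) * (ρ * (matPow σ (-q) * matPow σ q) * H * matPow σ q)).trace := by
        simp only [Matrix.mul_assoc]
    _ = (ρ * (matPow σ (-q) * matPow σ q) * H * matPow σ q * matPow σ (-q)).trace :=
        Matrix.trace_mul_comm _ _
    _ = (ρ * matPow σ 0 * (H * (matPow σ q * matPow σ (-q)))).trace := by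
        rw [e1]; simp only [Matrix.mul_assoc]
    _ = (matPow σ 0 * ρ * H).trace := by
        rw [h.mul_matPow_zero hσ, e2, ← Matrix.mul_assoc, Matrix.trace_mul_comm,
          Matrix.mul_assoc]
    _ = (ρ * H).trace := by rw [h.matPow_zero_mul hρ hσ]

lemma exists_sandTrace_eq {ρ σ : Matrix n n ℂ} (hρ : ρ.PosSemidef) (hσ : σ.PosSemidef) {α : ℝ}
    (hα : 1 < α) : ∃ H : Matrix n n ℂ, H.PosSemidef ∧ (ρ * H).trace.re = sandTrace α ρ σ ∧
      trPow (matPow σ ((α - 1) / α / 2) * H * matPow σ ((α - 1) / α / 2)) (α / (α - 1)) =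
        sandTrace α ρ σ := by
  have hexp : (1 - α) / (2 * α) = -((α - 1) / α / 2) := by
    field_simp
    ring
  unfold sandTrace
  rw [hexp]
  set q := (α - 1) / α / 2 with hq
  set X := matPow σ (-q) * ρ * matPow σ (-q) with hX
  have pX : X.PosSemidef := posSemidef_matPow_sandwich σ hρ (-q)
  have e1 : matPow σ q * matPow σ (-q) = matPow σ 0 := by
    rw [matPow_mul_matPow hσ, add_neg_cancel]
  have e2 : matPow σ (-q) * matPow σ q = matPow σ 0 := by
    rw [matPow_mul_matPow hσ, neg_add_cancel]
  have eX : X * matPow σ 0 = X := by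
    rw [hX, Matrix.mul_assoc, matPow_mul_matPow hσ, add_zero]
  have eX' : matPow σ 0 * X = X := by
    rw [hX, ← Matrix.mul_assoc, ← Matrix.mul_assoc, matPow_mul_matPow hσ, zero_add]
  have f1 : matPow X (α - 1) = X * matPow X (α - 2) := by
    conv_rhs => rw [← matPow_one pX, matPow_matPow pX, one_mul, matPow_mul_matPow pX]
    congr 1; ring
  have f2 : matPow X (α - 1) = matPow X (α - 2) * X := by
    conv_rhs => rw [← matPow_one pX, matPow_matPow pX, one_mul, matPow_mul_matPow pX]
    congr 1; ring
  refine ⟨matPow σ (-q) * matPow X (α - 1) * matPow σ (-q),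
    posSemidef_matPow_sandwich σ (matPow_posSemidef pX _) _, ?_, ?_⟩
  · have : (ρ * (matPow σ (-q) * matPow X (α - 1) * matPow σ (-q))).trace =
        (X * matPow X (α - 1)).trace := by
      rw [← Matrix.mul_assoc, Matrix.trace_mul_comm, hX]
      simp only [Matrix.mul_assoc]
    rw [this, trPow]
    conv_lhs => rw [← matPow_one pX, matPow_matPow pX, one_mul, matPow_mul_matPow pX]
    congr 3; ring
  · have : matPow σ q * (matPow σ (-q) * matPow X (α - 1) * matPow σ (-q)) * matPow σ q =
        matPow X (α - 1) := by
      calc _ = (matPow σ q * matPow σ (-q)) * matPow X (α - 1) *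
            (matPow σ (-q) * matPow σ q) := by simp only [Matrix.mul_assoc]
        _ = matPow X (α - 1) * matPow σ 0 := by
            rw [e1, e2, f1, ← Matrix.mul_assoc, eX']
        _ = _ := by rw [f2, Matrix.mul_assoc, eX]
    rw [this, trPow, matPow_matPow pX, mul_div_cancel₀ _ (by linarith), trPow]

lemma sandTrace_smul {ρ σ : Matrix n n ℂ} (hρ : ρ.PosSemidef) (hσ : σ.PosSemidef) {c α : ℝ}
    (hc : 0 < c) (hα : 1 < α) : sandTrace α ρ (c • σ) = c ^ (1 - α) * sandTrace α ρ σ := by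
  unfold sandTrace trPow
  rw [matPow_smul hσ hc]
  set r := (1 - α) / (2 * α) with hr
  have h1 : (c ^ r • matPow σ r) * ρ * (c ^ r • matPow σ r) =
      (c ^ r * c ^ r) • (matPow σ r * ρ * matPow σ r) := by
    rw [Matrix.smul_mul, Matrix.smul_mul, Matrix.mul_smul, smul_smul]
  have h2 : (c ^ r * c ^ r) ^ α = c ^ (1 - α) := by
    rw [← Real.rpow_add hc, ← Real.rpow_mul hc.le]
    congr 1
    rw [hr]
    field_simp
    ring
  rw [h1, matPow_smul (posSemidef_matPow_sandwich σ hρ r) (by positivity), h2,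
    Matrix.trace_smul, Complex.smul_re, smul_eq_mul]

/-- Data processing for the sandwiched Rényi trace functional, with a dominated second argument. -/
lemma sandTrace_dilate_le {ι κ E : Type} [Fintype ι] [DecidableEq ι] [Fintype κ] [DecidableEq κ]
    [Fintype E] [DecidableEq E] {V : Matrix (κ × E) ι ℂ} (hV : (1 - V * Vᴴ).PosSemidef)
    {ρ σ : Matrix ι ι ℂ} {τ : Matrix κ κ ℂ} (hρ : ρ.PosSemidef) (hσ : σ.PosSemidef)
    (hτ : τ.PosSemidef) (hle : (τ - dilate V σ).PosSemidef) (h : suppLE ρ σ) {α : ℝ}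
    (hα : 1 < α) : sandTrace α (dilate V ρ) τ ≤ sandTrace α ρ σ := by
  obtain ⟨H, hH, e1, e2⟩ := exists_sandTrace_eq (posSemidef_dilate V hρ) hτ hα
  have hs : 1 < α / (α - 1) := by
    rw [one_lt_div (by linarith)]
    linarith
  have hp : (α - 1) / α = 1 / (α / (α - 1)) := by rw [one_div_div]
  have hdual := trPow_dual_le hV hσ hτ hH hle hs hp
  have pH : (Vᴴ * (H ⊗ₖ (1 : Matrix E E ℂ)) * V).PosSemidef :=
    (hH.kronecker Matrix.PosSemidef.one).conjTranspose_mul_mul_same V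
  have h1 := re_trace_mul_le_sandTrace hρ hσ pH h hα
  rw [← trace_dilate_mul, e1] at h1
  rw [e2] at hdual
  have hp0 : 0 < (α - 1) / α := div_pos (by linarith) (by linarith)
  have h2 := h1.trans (mul_le_mul_of_nonneg_left (Real.rpow_le_rpow
    (trPow_nonneg (posSemidef_matPow_sandwich σ pH _) _) hdual hp0.le)
    (Real.rpow_nonneg (sandTrace_nonneg α σ hρ) _))
  have h3 : (α - 1) / α = 1 - 1 / α := by field_simp
  rw [h3] at h2
  exact le_of_le_rpow_mul_rpow (sandTrace_nonneg α τ (posSemidef_dilate V hρ))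
    (sandTrace_nonneg α σ hρ) (by positivity) h2

end Renyi

section Channel

lemma dilate_apply {ι κ E : Type} [Fintype ι] [Fintype E] (V : Matrix (κ × E) ι ℂ)
    (X : Matrix ι ι ℂ) (b b' : κ) :
    dilate V X b b' = ∑ a, ∑ a', X a a' * ∑ e, V (b, e) a * star (V (b', e) a') := by
  simp only [dilate, ptraceRight, Matrix.mul_apply, Matrix.conjTranspose_apply, Finset.sum_mul,
    Finset.mul_sum]
  rw [Finset.sum_comm]
  conv_lhs => enter [2, a']; rw [Finset.sum_comm]
  rw [Finset.sum_comm]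
  refine Finset.sum_congr rfl fun a _ => Finset.sum_congr rfl fun a' _ =>
    Finset.sum_congr rfl fun e _ => ?_
  ring

/-- A map with a Stinespring representation `X ↦ Tr_E (V X V*)`, with `V` an isometry. -/
def IsIsometricDilation {ι κ : Type} [Fintype ι] [DecidableEq ι] [Fintype κ]
    (Φ : Matrix ι ι ℂ → Matrix κ κ ℂ) : Prop :=
  ∃ (E : Type) (_ : Fintype E) (V : Matrix (κ × E) ι ℂ), Φ = dilate V ∧ Vᴴ * V = 1

lemma IsChannel.isIsometricDilation {ι κ : Type} [Fintype ι] [DecidableEq ι] [Fintype κ]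
    [DecidableEq κ] {Φ : Matrix ι ι ℂ → Matrix κ κ ℂ} (hΦ : IsChannel Φ) :
    IsIsometricDilation Φ := by
  let e := Fintype.equivFin ι
  let w : Fin (Fintype.card ι) × ι → ℂ := fun x => if e x.2 = x.1 then 1 else 0
  have hC := hΦ.compPos _ _ (Matrix.posSemidef_vecMulVec_self_star w)
  set C := idTensor Φ (Matrix.vecMulVec w (star w)) with hCdef
  obtain ⟨B, hB, hBB⟩ : ∃ B, Bᴴ = B ∧ B * B = C :=
    ⟨matPow C (1 / 2), matPow_conjTranspose _ _,
      by rw [matPow_mul_matPow hC, add_halves, matPow_one hC]⟩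
  have hCapp (a a' : ι) (b b' : κ) : C (e a, b) (e a', b') = Φ (Matrix.single a a' 1) b b' := by
    rw [hCdef, idTensor]
    congr 1
    ext x x'
    simp only [Matrix.vecMulVec_apply, w, Pi.star_apply, EmbeddingLike.apply_eq_iff_eq,
      Matrix.single_apply, eq_comm (a := a), eq_comm (a := a')]
    by_cases h1 : x = a <;> by_cases h2 : x' = a' <;> simp [h1, h2]
  let V : Matrix (κ × (Fin (Fintype.card ι) × κ)) ι ℂ := Matrix.of fun x a => B (e a, x.1) x.2
  have hV : Φ = dilate V := by
    funext X
    have hlin : Φ X = ∑ a, ∑ a', X a a' • Φ (Matrix.single a a' 1) := by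
      conv_lhs => rw [Matrix.matrix_eq_sum_single X]
      change hΦ.linear.mk' Φ _ = _
      simp only [map_sum]
      refine Finset.sum_congr rfl fun a _ => Finset.sum_congr rfl fun a' _ => ?_
      change Φ _ = _
      rw [← hΦ.linear.map_smul, Matrix.smul_single, smul_eq_mul, mul_one]
    ext b b'
    rw [hlin, dilate_apply]
    simp only [Matrix.sum_apply, Matrix.smul_apply, ← hCapp, ← hBB, Matrix.mul_apply,
      smul_eq_mul, V, Matrix.of_apply]
    refine Finset.sum_congr rfl fun a _ => Finset.sum_congr rfl fun a' _ => ?_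
    congr 1
    refine Finset.sum_congr rfl fun l _ => ?_
    rw [← Matrix.conjTranspose_apply, hB]
  refine ⟨_, inferInstance, V, hV, Matrix.ext_iff_trace_mul_left.2 fun X => ?_⟩
  have := hΦ.tracePres X
  rw [hV, dilate, trace_ptraceRight, Matrix.trace_mul_comm, ← Matrix.mul_assoc,
    Matrix.trace_mul_comm] at this
  rw [this, Matrix.mul_one]

variable {ι κ : Type} [Fintype ι] [DecidableEq ι] [Fintype κ]
  {Φ : Matrix ι ι ℂ → Matrix κ κ ℂ}

lemma IsIsometricDilation.idTensor {R : Type} [Fintype R] [DecidableEq R]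
    (hΦ : IsIsometricDilation Φ) : IsIsometricDilation (idTensor (R := R) Φ) := by
  obtain ⟨E, _, V, rfl, hV⟩ := hΦ
  refine ⟨E, inferInstance,
    Matrix.of fun x y => if x.1.1 = y.1 then V (x.1.2, x.2) y.2 else 0, ?_, ?_⟩
  · funext X
    ext p q
    rw [dilate_apply]
    refine (dilate_apply V (fun a b => X (p.1, a) (q.1, b)) _ _).trans ?_
    simp [Fintype.sum_prod_type, apply_ite]
  · ext ⟨s, a⟩ ⟨s', a'⟩
    have := congrFun (congrFun hV a) a'
    simp only [Matrix.mul_apply, Matrix.conjTranspose_apply, Fintype.sum_prod_type] at this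
    simp only [Matrix.mul_apply, Matrix.conjTranspose_apply, Matrix.of_apply,
      Fintype.sum_prod_type]
    by_cases h : s = s'
    · subst h
      simpa [Matrix.one_apply] using this
    · simp [h, Ne.symm h]

lemma IsIsometricDilation.posSemidef (hΦ : IsIsometricDilation Φ) {X : Matrix ι ι ℂ}
    (hX : X.PosSemidef) : (Φ X).PosSemidef := by
  obtain ⟨E, _, V, rfl, -⟩ := hΦ
  exact posSemidef_dilate V hX

lemma IsIsometricDilation.isDensity (hΦ : IsIsometricDilation Φ) {ρ : Matrix ι ι ℂ}
    (hρ : IsDensity ρ) : IsDensity (Φ ρ) := by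
  refine ⟨hΦ.posSemidef hρ.1, ?_⟩
  obtain ⟨E, _, V, rfl, hV⟩ := hΦ
  rw [dilate, trace_ptraceRight, Matrix.trace_mul_comm, ← Matrix.mul_assoc, hV, Matrix.one_mul,
    hρ.2]

lemma posSemidef_one_sub_of_isometry {m : Type} [Fintype m] [DecidableEq m] {V : Matrix m ι ℂ}
    (hV : Vᴴ * V = 1) : (1 - V * Vᴴ).PosSemidef := by
  have : 1 - V * Vᴴ = (1 - V * Vᴴ) * (1 - V * Vᴴ)ᴴ := by
    have h : V * Vᴴ * (V * Vᴴ) = V * Vᴴ := by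
      rw [Matrix.mul_assoc, ← Matrix.mul_assoc Vᴴ, hV, Matrix.one_mul]
    simp only [Matrix.conjTranspose_sub, Matrix.conjTranspose_one, Matrix.conjTranspose_mul,
      Matrix.conjTranspose_conjTranspose, Matrix.mul_sub, Matrix.sub_mul, Matrix.mul_one,
      Matrix.one_mul, h]
    simp
  rw [this]
  exact Matrix.posSemidef_self_mul_conjTranspose _

lemma suppLE.mul_eq_zero {ι ν : Type} [Fintype ι] {ρ σ : Matrix ι ι ℂ} (h : suppLE ρ σ) {K : Matrix ι ν ℂ}
    (hK : σ * K = 0) : ρ * K = 0 := by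
  ext i j
  exact congrFun (h (fun l => K l j) (funext fun i' => congrFun (congrFun hK i') j)) i

lemma mul_eq_zero_of_re_trace_mul_eq_zero {A K : Matrix ι ι ℂ} (hA : A.PosSemidef)
    (hK : K.PosSemidef) (h : (A * K).trace.re = 0) : A * K = 0 := by
  have half {B : Matrix ι ι ℂ} (hB : B.PosSemidef) :
      ∃ b : Matrix ι ι ℂ, bᴴ = b ∧ b * b = B :=
    ⟨matPow B (1 / 2), matPow_conjTranspose _ _,
      by rw [matPow_mul_matPow hB, add_halves, matPow_one hB]⟩
  obtain ⟨a, ha, rfl⟩ := half hA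
  obtain ⟨k, hk, rfl⟩ := half hK
  have hP : (a * k)ᴴ * (a * k) = k * (a * a) * k := by
    rw [Matrix.conjTranspose_mul, ha, hk]
    simp only [Matrix.mul_assoc]
  have ht : (k * (a * a) * k).trace = (a * a * (k * k)).trace := by
    rw [Matrix.mul_assoc, Matrix.trace_mul_comm, Matrix.mul_assoc]
  have pos := Matrix.posSemidef_conjTranspose_mul_self (a * k)
  have h0 : ((a * k)ᴴ * (a * k)).trace = 0 := by
    refine Complex.ext ?_ ?_
    · rw [hP, ht, h, Complex.zero_re]
    · exact (Complex.nonneg_iff.1 pos.trace_nonneg).2.symm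
  have h1 := Matrix.conjTranspose_mul_self_eq_zero.1 (pos.trace_eq_zero_iff.1 h0)
  calc a * a * (k * k) = a * (a * k) * k := by simp only [Matrix.mul_assoc]
    _ = 0 := by rw [h1, Matrix.mul_zero, Matrix.zero_mul]

lemma suppLE.dilate {E : Type} [Fintype E] (V : Matrix (κ × E) ι ℂ) {ρ σ : Matrix ι ι ℂ}
    {τ : Matrix κ κ ℂ} {c : ℝ} (hρ : ρ.PosSemidef) (hσ : σ.PosSemidef)
    (h : suppLE ρ σ) (hle : (c • τ - dilate V σ).PosSemidef) : suppLE (dilate V ρ) τ := by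
  intro v hv
  have pP := Matrix.posSemidef_vecMulVec_self_star v
  set P := Matrix.vecMulVec v (star v) with hP
  have pK : (Vᴴ * (P ⊗ₖ (1 : Matrix E E ℂ)) * V).PosSemidef :=
    (pP.kronecker Matrix.PosSemidef.one).conjTranspose_mul_mul_same V
  have hmul (A : Matrix κ κ ℂ) : A * P = Matrix.vecMulVec (A.mulVec v) (star v) := by
    rw [hP, Matrix.mul_vecMulVec]
  have hle' := re_trace_mul_mono pP hle
  rw [Matrix.smul_mul, hmul τ, hv, Matrix.zero_vecMulVec, smul_zero, Matrix.trace_zero,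
    trace_dilate_mul] at hle'
  have h0 := mul_eq_zero_of_re_trace_mul_eq_zero hσ pK
    (le_antisymm hle' (re_trace_mul_nonneg hσ pK))
  have h1 := mul_eq_zero_of_re_trace_mul_eq_zero (posSemidef_dilate V hρ) pP
    (by rw [trace_dilate_mul, h.mul_eq_zero h0, Matrix.trace_zero, Complex.zero_re])
  rw [hmul] at h1
  have h2 := congrArg (fun A => A.mulVec v) h1
  simp only [Matrix.vecMulVec_mulVec, Matrix.zero_mulVec] at h2
  by_contra hne
  have hv0 : star v ⬝ᵥ v = 0 := by
    simpa [hne] using h2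
  rw [dotProduct_star_self_eq_zero.1 hv0] at hne
  simp at hne

end Channel

section RenyiBounds

variable {ι κ : Type} [Fintype ι] [DecidableEq ι] [Fintype κ] [DecidableEq κ]
  {Φ : Matrix ι ι ℂ → Matrix κ κ ℂ}

lemma sandRenyi_of_suppLE {α : ℝ} (hα : 1 < α) {ρ σ : Matrix ι ι ℂ} (h : suppLE ρ σ) :
    sandRenyi α ρ σ = (((α - 1)⁻¹ * Real.logb 2 (sandTrace α ρ σ) : ℝ) : EReal) := by
  rw [sandRenyi, if_neg hα.ne', if_neg (by simp [h]), if_neg (by simp [hα.le.not_gt])]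
  rfl

lemma sandRenyi_of_not_suppLE {α : ℝ} (hα : 1 < α) {ρ σ : Matrix ι ι ℂ} (h : ¬ suppLE ρ σ) :
    sandRenyi α ρ σ = ⊤ := by
  rw [sandRenyi, if_neg hα.ne', if_pos ⟨hα, h⟩]

lemma sandRenyi_ne_bot {α : ℝ} (hα : 1 < α) (ρ σ : Matrix ι ι ℂ) : sandRenyi α ρ σ ≠ ⊥ := by
  by_cases h : suppLE ρ σ
  · rw [sandRenyi_of_suppLE hα h]
    exact EReal.coe_ne_bot _
  · simp [sandRenyi_of_not_suppLE hα h]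

lemma suppLE_of_sandRenyi_ne_top {α : ℝ} (hα : 1 < α) {ρ σ : Matrix ι ι ℂ}
    (h : sandRenyi α ρ σ ≠ ⊤) : suppLE ρ σ :=
  not_imp_comm.1 (sandRenyi_of_not_suppLE hα) h

lemma sandTrace_pos {α : ℝ} (hα : 1 < α) {ρ σ : Matrix ι ι ℂ} (hρ : IsDensity ρ)
    (hσ : σ.PosSemidef) (h : suppLE ρ σ) : 0 < sandTrace α ρ σ := by
  refine (sandTrace_nonneg α σ hρ.1).lt_of_ne fun h0 => ?_
  have := re_trace_mul_le_sandTrace hρ.1 hσ Matrix.PosSemidef.one h hα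
  rw [← h0, Real.zero_rpow (by positivity), zero_mul, Matrix.mul_one, hρ.2, Complex.one_re] at this
  linarith

lemma sandRenyi_self {α : ℝ} (hα : 1 < α) {ρ : Matrix ι ι ℂ} (hρ : IsDensity ρ) :
    sandRenyi α ρ ρ = 0 := by
  have h : sandTrace α ρ ρ = 1 := by
    set r := (1 - α) / (2 * α) with hr
    have e : matPow ρ r * ρ * matPow ρ r = matPow ρ (r + 1 + r) := by
      conv_lhs => enter [1, 2]; rw [← matPow_one hρ.1]
      rw [matPow_mul_matPow hρ.1, matPow_mul_matPow hρ.1]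
    have e' : (r + 1 + r) * α = 1 := by
      rw [hr]
      field_simp
      ring
    rw [sandTrace, ← hr, e, trPow, matPow_matPow hρ.1, e', matPow_one hρ.1, hρ.2, Complex.one_re]
  rw [sandRenyi_of_suppLE hα fun _ => id, h]
  simp

/-- Data processing for the sandwiched Rényi divergence, with a dominated second argument. -/
lemma IsIsometricDilation.sandRenyi_le (hΦ : IsIsometricDilation Φ) {ρ σ : Matrix ι ι ℂ}
    {τ : Matrix κ κ ℂ} (hρ : IsDensity ρ) (hσ : IsDensity σ) (hτ : τ.PosSemidef) {l : ℝ}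
    (hle : ((2 : ℝ) ^ l • τ - Φ σ).PosSemidef) {α : ℝ} (hα : 1 < α) :
    sandRenyi α (Φ ρ) τ ≤ l + sandRenyi α ρ σ := by
  by_cases h : suppLE ρ σ
  swap
  · rw [sandRenyi_of_not_suppLE hα h, EReal.coe_add_top]
    exact le_top
  have dΦρ := hΦ.isDensity hρ
  obtain ⟨E, _, V, rfl, hV⟩ := hΦ
  have c0 : (0 : ℝ) < 2 ^ l := by positivity
  have hs := h.dilate V hρ.1 hσ.1 hle
  have key := sandTrace_dilate_le (posSemidef_one_sub_of_isometry hV) hρ.1 hσ.1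
    (hτ.smul c0.le) hle h hα
  rw [sandTrace_smul dΦρ.1 hτ c0 hα, ← Real.rpow_mul zero_le_two] at key
  rw [sandRenyi_of_suppLE hα h, sandRenyi_of_suppLE hα hs, ← EReal.coe_add, EReal.coe_le_coe_iff]
  have p := sandTrace_pos hα dΦρ hτ hs
  have h2 : l * (1 - α) + Real.logb 2 (sandTrace α (_root_.dilate V ρ) τ) ≤
      Real.logb 2 (sandTrace α ρ σ) := by
    have := Real.logb_le_logb_of_le one_lt_two (by positivity) key
    rwa [Real.logb_mul (by positivity) p.ne', Real.logb_rpow two_pos (by norm_num)] at this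
  have hα' : 0 < α - 1 := by linarith
  rw [inv_mul_le_iff₀ hα', mul_add, mul_inv_cancel_left₀ hα'.ne']
  linarith

lemma IsIsometricDilation.sandRenyi_map_le (hΦ : IsIsometricDilation Φ) {ρ σ : Matrix ι ι ℂ}
    (hρ : IsDensity ρ) (hσ : IsDensity σ) {α : ℝ} (hα : 1 < α) :
    sandRenyi α (Φ ρ) (Φ σ) ≤ sandRenyi α ρ σ := by
  have := hΦ.sandRenyi_le hρ hσ (hΦ.posSemidef hσ.1) (l := 0)
    (by simpa using Matrix.PosSemidef.zero) hα
  simpa using this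

lemma matPow_one_left (s : ℝ) : matPow (1 : Matrix ι ι ℂ) s = 1 := by
  rw [matPow, hermFun_eq_cfc _ Matrix.isHermitian_one, cfc_apply_one]
  simp

lemma sandTrace_unit {α p q : ℝ} (hp : 0 < p) (hq : 0 < q) (hα : 1 < α) :
    sandTrace α (p • (1 : Matrix Unit Unit ℂ)) (q • (1 : Matrix Unit Unit ℂ)) =
      p ^ α * q ^ (1 - α) := by
  have pp : (p • (1 : Matrix Unit Unit ℂ)).PosSemidef := Matrix.PosSemidef.one.smul hp.le
  rw [sandTrace_smul pp Matrix.PosSemidef.one hq hα, sandTrace, matPow_one_left, Matrix.one_mul,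
    Matrix.mul_one, trPow, matPow_smul Matrix.PosSemidef.one hp, matPow_one_left, mul_comm]
  simp

/-- A test `Q` yields a classical lower bound on the sandwiched Rényi trace functional. -/
lemma rpow_mul_rpow_le_sandTrace {ρ σ Q : Matrix ι ι ℂ} (hρ : ρ.PosSemidef) (hσ : σ.PosSemidef)
    (hQ : Q.PosSemidef) (hQ1 : (1 - Q).PosSemidef) (h : suppLE ρ σ) {α : ℝ} (hα : 1 < α)
    (hp : 0 < (Q * ρ).trace.re) :
    0 < (Q * σ).trace.re ∧
      (Q * ρ).trace.re ^ α * (Q * σ).trace.re ^ (1 - α) ≤ sandTrace α ρ σ := by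
  have hq : 0 < (Q * σ).trace.re := by
    rw [Matrix.trace_mul_comm]
    refine (re_trace_mul_nonneg hσ hQ).lt_of_ne fun h0 => ?_
    rw [Matrix.trace_mul_comm,
      h.mul_eq_zero (mul_eq_zero_of_re_trace_mul_eq_zero hσ hQ h0.symm)] at hp
    simp at hp
  refine ⟨hq, ?_⟩
  obtain ⟨k, hk, hkk⟩ : ∃ k : Matrix ι ι ℂ, kᴴ = k ∧ k * k = Q :=
    ⟨matPow Q (1 / 2), matPow_conjTranspose _ _,
      by rw [matPow_mul_matPow hQ, add_halves, matPow_one hQ]⟩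
  let V : Matrix (Unit × ι) ι ℂ := k.submatrix Prod.snd id
  have hVX (A : Matrix ι ι ℂ) : V * A * Vᴴ = (k * A * k).submatrix Prod.snd Prod.snd := by
    rw [Matrix.conjTranspose_submatrix, hk]
    rfl
  have hV : (1 - V * Vᴴ).PosSemidef := by
    have : 1 - V * Vᴴ = (1 - Q).submatrix Prod.snd Prod.snd := by
      have := hVX 1
      rw [Matrix.mul_one, Matrix.mul_one, hkk] at this
      rw [this]
      ext ⟨_, i⟩ ⟨_, j⟩
      simp [Matrix.one_apply]
    rw [this]
    exact hQ1.submatrix _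
  have hd {A : Matrix ι ι ℂ} (hA : A.PosSemidef) :
      dilate V A = (Q * A).trace.re • (1 : Matrix Unit Unit ℂ) := by
    have ht : (Q * A).trace = (((Q * A).trace.re : ℝ) : ℂ) := by
      have := (hA.mul_mul_conjTranspose_same k).trace_nonneg
      rw [hk, Matrix.mul_assoc, Matrix.trace_mul_comm, Matrix.mul_assoc, hkk,
        Matrix.trace_mul_comm] at this
      exact Complex.ext rfl (Complex.nonneg_iff.1 this).2.symm
    ext
    have : dilate V A () () = (k * A * k).trace := by
      rw [dilate, hVX]
      rfl
    rw [this, Matrix.mul_assoc, Matrix.trace_mul_comm, Matrix.mul_assoc, hkk,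
      Matrix.trace_mul_comm, ht]
    simp
  rw [← sandTrace_unit hp hq hα, ← hd hρ, ← hd hσ]
  exact sandTrace_dilate_le hV hρ hσ (posSemidef_dilate V hσ)
    (by simpa using Matrix.PosSemidef.zero) h hα

end RenyiBounds

section Amortized

variable {ι κ : Type} [Fintype ι] [DecidableEq ι] [Fintype κ] [DecidableEq κ]
  {N M : Matrix ι ι ℂ → Matrix κ κ ℂ} {m : ℕ}

lemma Protocol.isDensity_evolve (P : Protocol ι κ m) (hN : IsIsometricDilation N) :
    ∀ i ≤ m, IsDensity (P.evolve N i)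
  | 0, _ => P.init_density
  | i + 1, hi => ((P.adapt_channel i hi).isIsometricDilation).isDensity
      (hN.idTensor.isDensity (P.isDensity_evolve hN i (Nat.le_of_succ_le hi)))

lemma sandRenyi_idTensor_le {R : ℕ} {ρ σ : Matrix (Fin R × ι) (Fin R × ι) ℂ} (hρ : IsDensity ρ)
    (hσ : IsDensity σ) {α d x : ℝ} (hα : 1 < α) (hd : amortizedDiv (sandFam α) N M ≤ d)
    (hx : sandRenyi α ρ σ ≤ x) :
    sandRenyi α (idTensor N ρ) (idTensor M σ) ≤ ((x + d : ℝ) : EReal) := by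
  have h1 : sandRenyi α (idTensor N ρ) (idTensor M σ) - sandRenyi α ρ σ ≤ d := by
    refine le_trans ?_ hd
    exact le_iSup_of_le R (le_iSup_of_le ρ (le_iSup_of_le σ (le_iSup_of_le hρ
      (le_iSup_of_le hσ le_rfl))))
  have h2 := (EReal.sub_le_iff_le_add (.inl (sandRenyi_ne_bot hα _ _))
    (.inl (ne_top_of_le_ne_top (EReal.coe_ne_top x) hx))).1 h1
  refine h2.trans ?_
  rw [add_comm x d, EReal.coe_add]
  gcongr

lemma Protocol.sandRenyi_evolve_le (P : Protocol ι κ m) (hN : IsIsometricDilation N)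
    (hM : IsIsometricDilation M) {α d : ℝ} (hα : 1 < α)
    (hd : amortizedDiv (sandFam α) N M ≤ d) :
    ∀ i ≤ m, sandRenyi α (P.evolve N i) (P.evolve M i) ≤ ((i * d : ℝ) : EReal)
  | 0, _ => by
    rw [Protocol.evolve, Protocol.evolve, sandRenyi_self hα P.init_density]
    simp
  | i + 1, hi => by
    have hi' := Nat.le_of_succ_le hi
    have dN := P.isDensity_evolve hN i hi'
    have dM := P.isDensity_evolve hM i hi'
    refine ((P.adapt_channel i hi).isIsometricDilation.sandRenyi_map_le
      (hN.idTensor.isDensity dN) (hM.idTensor.isDensity dM) hα).trans ?_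
    refine (sandRenyi_idTensor_le dN dM hα hd (P.sandRenyi_evolve_le hN hM hα hd i hi')).trans ?_
    rw [Nat.cast_succ, add_one_mul]

lemma Protocol.one_sub_typeI (P : Protocol ι κ m) (hN : IsIsometricDilation N) :
    1 - P.typeI N = (P.meas * P.final N).trace.re := by
  have h : (P.final N).trace = 1 :=
    (hN.idTensor.isDensity (P.isDensity_evolve hN m le_rfl)).2
  rw [Protocol.typeI, Matrix.sub_mul, Matrix.one_mul, Matrix.trace_sub, h, Complex.sub_re,
    Complex.one_re, sub_sub_cancel]

lemma Protocol.le_negLog2_of_amortizedDiv_le (P : Protocol ι κ m) (hN : IsIsometricDilation N)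
    (hM : IsIsometricDilation M) {r : ℝ}
    (hβ : P.typeII M ≤ (2 : ℝ) ^ (-(r * (m + 1 : ℝ)))) {α d : ℝ} (hα : 1 < α)
    (hd : amortizedDiv (sandFam α) N M ≤ d) :
    (((α - 1) / α * (r - d) : ℝ) : EReal) ≤
      (((m + 1 : ℝ))⁻¹ : EReal) * negLog2 (1 - P.typeI N) := by
  have hm : (0 : ℝ) < m + 1 := by positivity
  rw [← EReal.coe_inv, negLog2]
  split_ifs with hp
  · rw [EReal.coe_mul_top_of_pos (inv_pos.2 hm)]
    exact le_top
  rw [not_le] at hp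
  rw [← EReal.coe_mul, EReal.coe_le_coe_iff]
  have dN := P.isDensity_evolve hN m le_rfl
  have dM := P.isDensity_evolve hM m le_rfl
  have hfin := sandRenyi_idTensor_le dN dM hα hd (P.sandRenyi_evolve_le hN hM hα hd m le_rfl)
  have hs := suppLE_of_sandRenyi_ne_top hα (ne_top_of_le_ne_top (EReal.coe_ne_top _) hfin)
  rw [sandRenyi_of_suppLE hα hs, EReal.coe_le_coe_iff] at hfin
  rw [P.one_sub_typeI hN] at hp ⊢
  obtain ⟨hq, hpq⟩ := rpow_mul_rpow_le_sandTrace (hN.idTensor.isDensity dN).1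
    (hM.idTensor.isDensity dM).1 P.meas_psd P.meas_le_one hs hα hp
  rw [Protocol.typeII] at hβ
  change 0 < (P.meas * P.final M).trace.re at hq
  change (P.meas * P.final N).trace.re ^ α * (P.meas * P.final M).trace.re ^ (1 - α) ≤ _ at hpq
  set p := (P.meas * P.final N).trace.re
  set q := (P.meas * P.final M).trace.re
  have h1 := Real.logb_le_logb_of_le one_lt_two (by positivity) hpq
  rw [Real.logb_mul (by positivity) (by positivity), Real.logb_rpow_eq_mul_logb_of_pos hp,
    Real.logb_rpow_eq_mul_logb_of_pos hq] at h1
  have h2 := Real.logb_le_logb_of_le one_lt_two hq hβ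
  rw [Real.logb_rpow two_pos (by norm_num)] at h2
  have hα' : 0 < α - 1 := by linarith
  rw [inv_mul_le_iff₀ hα'] at hfin
  have h3 := mul_le_mul_of_nonneg_left h2 hα'.le
  rw [← div_eq_inv_mul, le_div_iff₀ hm, div_mul_eq_mul_div, div_mul_eq_mul_div,
    div_le_iff₀ (by linarith)]
  linarith

lemma Protocol.amortizedDiv_ne_bot (P : Protocol ι κ m) {α : ℝ} (hα : 1 < α) :
    amortizedDiv (sandFam α) N M ≠ ⊥ := by
  intro h
  have h1 : sandRenyi α (idTensor N P.init) (idTensor M P.init) -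
      sandRenyi α P.init P.init ≤ ⊥ := by
    rw [← h]
    exact le_iSup_of_le (P.r 0) (le_iSup_of_le P.init (le_iSup_of_le P.init
      (le_iSup_of_le P.init_density (le_iSup_of_le P.init_density le_rfl))))
  rw [sandRenyi_self hα P.init_density, sub_zero, le_bot_iff] at h1
  exact sandRenyi_ne_bot hα _ _ h1

lemma amortizedDiv_sandFam_le (hN : IsIsometricDilation N) (hM : IsIsometricDilation M) {l : ℝ}
    (hl : channelDiv DmaxFam N M < l) {α : ℝ} (hα : 1 < α) :
    amortizedDiv (sandFam α) N M ≤ l := by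
  refine iSup_le fun R => iSup_le fun ρ => iSup_le fun σ => iSup_le fun hρ => iSup_le fun hσ => ?_
  have h1 : Dmax (idTensor N σ) (idTensor M σ) < l :=
    lt_of_le_of_lt (le_iSup₂_of_le (f := fun R ρ => ⨆ _ : IsDensity ρ,
      DmaxFam (Fin R × κ) (idTensor N ρ) (idTensor M ρ)) R σ (le_iSup_of_le hσ le_rfl)) hl
  obtain ⟨l', h2⟩ := iInf_lt_iff.1 h1
  obtain ⟨hle, h3⟩ := iInf_lt_iff.1 h2
  refine EReal.sub_le_of_le_add ?_
  refine (hN.idTensor.sandRenyi_le hρ hσ (hM.idTensor.isDensity hσ).1 hle hα).trans ?_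
  gcongr
  rfl

lemma sub_channelDiv_le (hN : IsIsometricDilation N) (hM : IsIsometricDilation M) (r : ℝ) :
    (r : EReal) - channelDiv DmaxFam N M ≤
      ⨆ (α : ℝ) (_ : 1 < α),
        ((((α - 1) / α) : ℝ) : EReal) * ((r : EReal) - amortizedDiv (sandFam α) N M) := by
  refine EReal.ge_of_forall_gt_iff_ge.1 fun c hc => ?_
  have hc' : channelDiv DmaxFam N M < ((r - c : ℝ) : EReal) := by
    rw [EReal.lt_sub_iff_add_lt (.inr (EReal.coe_ne_top _)) (.inr (EReal.coe_ne_bot _)),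
      add_comm] at hc
    rwa [EReal.coe_sub, EReal.lt_sub_iff_add_lt (.inl (EReal.coe_ne_bot _))
      (.inl (EReal.coe_ne_top _))]
  obtain ⟨l, hl, hlc⟩ := EReal.lt_iff_exists_real_btwn.1 hc'
  rw [EReal.coe_lt_coe_iff] at hlc
  have hδ : 0 < r - l - c := by linarith
  set α := 2 + |r - l| / (r - l - c) with hα_def
  have hα : 1 < α := by
    have : 0 ≤ |r - l| / (r - l - c) := by positivity
    linarith
  refine le_iSup₂_of_le α hα ?_
  have h1 : c ≤ (α - 1) / α * (r - l) := by
    rw [div_mul_eq_mul_div, le_div_iff₀ (by linarith)]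
    have : α * (r - l - c) = 2 * (r - l - c) + |r - l| := by
      rw [hα_def, add_mul, div_mul_cancel₀ _ hδ.ne']
    linarith [le_abs_self (r - l)]
  refine (EReal.coe_le_coe_iff.2 h1).trans ?_
  rw [EReal.coe_mul, EReal.coe_sub]
  have h2 : (0 : EReal) ≤ (((α - 1) / α : ℝ) : EReal) :=
    EReal.coe_nonneg.2 (div_nonneg (by linarith) (by linarith))
  have h3 := amortizedDiv_sandFam_le hN hM hl hα
  gcongr
  exact EReal.sub_le_sub le_rfl h3

end Amortized

/-- Strong converse exponent bound: for an `n = m + 1`-round adaptive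
protocol with `β_n ≤ 2^{−rn}`,
`−(1/n) log₂(1 − α_n) ≥ sup_{α>1} ((α−1)/α)(r − D̃_α^𝒜(N‖M)) ≥ r − D_max(N‖M)`. -/
theorem strong_converse_exponent_bound
    {ι κ : Type} [Fintype ι] [DecidableEq ι] [Fintype κ] [DecidableEq κ]
    (N M : Matrix ι ι ℂ → Matrix κ κ ℂ) (hN : IsChannel N) (hM : IsChannel M)
    (m : ℕ) (r : ℝ) (hr : 0 < r) (P : Protocol ι κ m)
    (hβ : P.typeII M ≤ (2 : ℝ) ^ (-(r * (m + 1 : ℝ)))) :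
    (⨆ (α : ℝ) (_ : 1 < α),
        ((((α - 1) / α) : ℝ) : EReal) * ((r : EReal) - amortizedDiv (sandFam α) N M)) ≤
      (((m + 1 : ℝ))⁻¹ : EReal) * negLog2 (1 - P.typeI N) ∧
    (r : EReal) - channelDiv DmaxFam N M ≤
      ⨆ (α : ℝ) (_ : 1 < α),
        ((((α - 1) / α) : ℝ) : EReal) * ((r : EReal) - amortizedDiv (sandFam α) N M) := by
  have dN := hN.isIsometricDilation
  have dM := hM.isIsometricDilation
  refine ⟨iSup_le fun α => iSup_le fun hα => ?_, sub_channelDiv_le dN dM r⟩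
  have hk : 0 < (α - 1) / α := div_pos (by linarith) (by linarith)
  by_cases ht : amortizedDiv (sandFam α) N M = ⊤
  · rw [ht, EReal.sub_top, EReal.coe_mul_bot_of_pos hk]
    exact bot_le
  · have hd := EReal.coe_toReal ht (P.amortizedDiv_ne_bot hα)
    rw [← hd, ← EReal.coe_sub, ← EReal.coe_mul]
    exact P.le_negLog2_of_amortizedDiv_le dN dM hβ hα hd.ge

end
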